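/- arXiv:math/0310317 — 3 statements merged into one kernel-verified Lean document; each statement's English description precedes it below -/
import Mathlib

section
/- (Complexity of the Pascal subshift) For each n ≥ 1 let p_n be the number of distinct words of length n in the language L(ζ), i.e., the cardinality of the (finite) set of words u of length n such that u is an infix of some basic block B(l,k). Then p_n / n³ → 1/6 as n → ∞. -/
open Filter

/-- The basic blocks of the Pascal triangle of words (`a = false`, `b = true`):
`B(n,0) = a`, `B(n,n) = b`, and `B(n,k) = B(n−1,k) ++ B(n−1,k−1)` for `0 < k < n`. -/
def Bblk : ℕ → ℕ → List Bool
  | 0, _ => [true]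
  | _ + 1, 0 => [false]
  | n + 1, k + 1 => if k + 1 = n + 1 then [true] else Bblk n (k + 1) ++ Bblk n k

/-- The complexity function of the Pascal subshift: the number of distinct
words of length `n` occurring as infixes of basic blocks. -/
noncomputable def pComplexity (n : ℕ) : ℕ :=
  {u : List Bool | u.length = n ∧ ∃ l k, 1 ≤ l ∧ k ≤ l ∧ u <:+: Bblk l k}.ncard


namespace PascalWords

lemma Bblk_zero_right (n : ℕ) : Bblk (n + 1) 0 = [false] := rfl

lemma Bblk_self (n : ℕ) : Bblk n n = [true] := by
  cases n <;> simp [Bblk]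

lemma Bblk_succ_succ {n k : ℕ} (h : k < n) :
    Bblk (n + 1) (k + 1) = Bblk n (k + 1) ++ Bblk n k := by
  rw [Bblk, if_neg (by omega)]

lemma length_Bblk {n k : ℕ} (hn : 1 ≤ n) (hk : k ≤ n) : (Bblk n k).length = n.choose k := by
  induction n, hn using Nat.le_induction generalizing k with
  | base => interval_cases k <;> simp [Bblk]
  | succ n hn ih =>
    rcases k with _ | k
    · simp [Bblk]
    · rcases hk.eq_or_lt with h | h
      · rw [h, Bblk_self]; simp
      · rw [Bblk_succ_succ (by omega), List.length_append, ih (by omega), ih (by omega),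
          Nat.choose_succ_succ', add_comm]

/-- Reversal of a word combined with the exchange of the two letters. -/
def flip (u : List Bool) : List Bool := (u.map not).reverse

@[simp] lemma flip_flip (u : List Bool) : flip (flip u) = u := by
  simp [flip, Function.comp_def]

@[simp] lemma flip_append (u v : List Bool) : flip (u ++ v) = flip v ++ flip u := by
  simp [flip]

@[simp] lemma length_flip (u : List Bool) : (flip u).length = u.length := by
  simp [flip]

@[simp] lemma flip_replicate (n : ℕ) (c : Bool) :
    flip (List.replicate n c) = List.replicate n (!c) := by
  simp [flip]

lemma flip_suffix_flip {u v : List Bool} (h : u <+: v) : flip u <:+ flip v := by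
  obtain ⟨s, rfl⟩ := h
  exact ⟨flip s, by simp⟩

lemma flip_prefix_flip {u v : List Bool} (h : u <:+ v) : flip u <+: flip v := by
  obtain ⟨s, rfl⟩ := h
  exact ⟨flip s, by simp⟩

lemma flip_infix_flip {u v : List Bool} (h : u <:+: v) : flip u <:+: flip v := by
  obtain ⟨s, t, rfl⟩ := h
  exact ⟨flip t, flip s, by simp⟩

lemma flip_Bblk {p k : ℕ} (h : 1 ≤ p + k) : flip (Bblk (p + k) k) = Bblk (p + k) p := by
  obtain ⟨n, hn⟩ : ∃ n, n = p + k := ⟨_, rfl⟩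
  induction n generalizing p k with
  | zero => omega
  | succ n ih =>
    rcases p with _ | p
    · obtain rfl : k = n + 1 := by omega
      rw [zero_add, Bblk_self]; rfl
    rcases k with _ | k
    · rw [add_zero, Bblk_self]; rfl
    have e : p + 1 + (k + 1) = (p + k + 1) + 1 := by omega
    rw [e, Bblk_succ_succ (k := k) (by omega), Bblk_succ_succ (k := p) (by omega), flip_append]
    have h1 := ih (p := p + 1) (k := k) (by omega) (by omega)
    have h2 := ih (p := p) (k := k + 1) (by omega) (by omega)
    rw [show p + 1 + k = p + k + 1 by omega] at h1
    rw [show p + (k + 1) = p + k + 1 by omega] at h2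
    rw [h1, h2]

lemma Bblk_one (p : ℕ) : Bblk (p + 1) 1 = true :: List.replicate p false := by
  induction p with
  | zero => rfl
  | succ p ih => rw [Bblk_succ_succ (by omega), ih, Bblk_zero_right, List.replicate_succ']; rfl

lemma Bblk_suffix {p i j : ℕ} (hp : 1 ≤ p) (hij : i ≤ j) :
    Bblk (p + i) i <:+ Bblk (p + j) j := by
  induction j, hij using Nat.le_induction with
  | base => exact List.suffix_rfl
  | succ j _ ih =>
    refine ih.trans ?_
    rw [← add_assoc, Bblk_succ_succ (by omega)]
    exact List.suffix_append _ _

lemma replicate_suffix_Bblk {p k : ℕ} (hp : 1 ≤ p) (hk : 1 ≤ k) :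
    List.replicate p false <:+ Bblk (p + k) k :=
  (by rw [Bblk_one]; exact List.suffix_cons _ _ :
    List.replicate p false <:+ Bblk (p + 1) 1).trans (Bblk_suffix hp hk)

/-! ### Upper bound -/

/-- A finite set containing every suffix of length `s` of a basic block. -/
def suffixes (s : ℕ) : Finset (List Bool) :=
  insert (List.replicate s false)
    ((Finset.range s).image fun p => (Bblk (p + s) s).drop ((Bblk (p + s) s).length - s))

lemma card_suffixes_le (s : ℕ) : (suffixes s).card ≤ s + 1 := by
  refine (Finset.card_insert_le _ _).trans ?_
  simpa using Finset.card_image_le (s := Finset.range s)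
    (f := fun p => (Bblk (p + s) s).drop ((Bblk (p + s) s).length - s))

lemma eq_of_suffix {u v w : List Bool} (hu : u <:+ w) (hv : v <:+ w)
    (h : u.length = v.length) : u = v :=
  (List.suffix_of_suffix_length_le hu hv h.le).eq_of_length h

lemma mem_suffixes {u : List Bool} {p k : ℕ} (h : 1 ≤ p + k) (hu : u <:+ Bblk (p + k) k) :
    u ∈ suffixes u.length := by
  obtain ⟨s, hs⟩ : ∃ s, s = u.length := ⟨_, rfl⟩
  rw [← hs]
  rcases Nat.eq_zero_or_pos s with h0 | hpos
  · subst h0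
    rw [List.length_eq_zero_iff.1 hs.symm]
    simp [suffixes]
  rcases Nat.eq_zero_or_pos p with rfl | hp
  · rw [zero_add, Bblk_self] at hu
    have hl := hu.length_le
    simp only [List.length_singleton] at hl
    obtain rfl : s = 1 := by omega
    have := hu.eq_of_length (by simp [← hs])
    subst this
    simp [suffixes, Bblk]
  rcases le_or_gt s p with hsp | hsp
  · refine Finset.mem_insert.2 (Or.inl ?_)
    refine eq_of_suffix (hu.trans (Bblk_suffix hp (Nat.le_succ k))) (List.IsSuffix.trans ?_
      (replicate_suffix_Bblk (k := k + 1) hp (by omega))) (by simp [hs])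
    exact ⟨List.replicate (p - s) false, by simp; omega⟩
  · refine Finset.mem_insert.2 (Or.inr (Finset.mem_image.2 ⟨p, by simpa using hsp, ?_⟩))
    have hlen : s ≤ (Bblk (p + s) s).length := by
      rw [length_Bblk (by omega) (by omega)]
      have h1 : (s + 1).choose s ≤ (p + s).choose s := Nat.choose_le_choose _ (by omega)
      rw [Nat.choose_succ_self_right] at h1
      omega
    symm
    refine eq_of_suffix (hu.trans (Bblk_suffix hp (le_max_left k s)))
      ((List.drop_suffix _ _).trans (Bblk_suffix hp (le_max_right k s))) ?_
    rw [List.length_drop]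
    omega

lemma exists_split {u : List Bool} {l k : ℕ} (hl : 1 ≤ l) (hk : k ≤ l) (hu : u <:+: Bblk l k) :
    ∃ x ∈ suffixes x.length, ∃ y, flip y ∈ suffixes y.length ∧ u = x ++ y := by
  induction l, hl using Nat.le_induction generalizing k with
  | base =>
    refine ⟨u, mem_suffixes (p := 1 - k) (k := k) (by omega) ?_, [], by simp [suffixes, flip],
      by simp⟩
    rw [Nat.sub_add_cancel hk]
    obtain ⟨c, hc⟩ : ∃ c, Bblk 1 k = [c] := by interval_cases k <;> simp [Bblk]
    rw [hc] at hu ⊢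
    rcases List.infix_cons_iff.1 hu with h | h
    · rcases List.prefix_cons_iff.1 h with rfl | ⟨t, rfl, ht⟩
      · exact List.nil_suffix
      · rw [List.prefix_nil.1 ht]
    · rw [List.infix_nil.1 h]; exact List.nil_suffix
  | succ l hl ih =>
    rcases k with _ | k
    · refine ih (k := 0) (by omega) ?_
      obtain ⟨l, rfl⟩ : ∃ l', l = l' + 1 := ⟨l - 1, by omega⟩
      exact hu
    rcases hk.eq_or_lt with h | h
    · refine ih (k := l) le_rfl ?_
      rw [h, Bblk_self] at hu
      rwa [Bblk_self]
    rw [Bblk_succ_succ (by omega), List.infix_append_iff] at hu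
    rcases hu with hu | hu | ⟨x, y, rfl, hx, hy⟩
    · exact ih (by omega) hu
    · exact ih (by omega) hu
    · refine ⟨x, ?_, y, ?_, rfl⟩
      · refine mem_suffixes (p := l - (k + 1)) (k := k + 1) (by omega) ?_
        rwa [Nat.sub_add_cancel (by omega)]
      · have := mem_suffixes (u := flip y) (p := k) (k := l - k) (by omega) ?_
        · simpa using this
        · have h2 := flip_Bblk (p := l - k) (k := k) (by omega)
          rw [Nat.sub_add_cancel (by omega)] at h2
          rw [show k + (l - k) = l by omega, ← h2]
          exact flip_suffix_flip hy

lemma sum_mul_reflect (n : ℕ) :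
    6 * ∑ i ∈ Finset.range n, (i + 1) * (n - i) = n * (n + 1) * (n + 2) := by
  induction n with
  | zero => rfl
  | succ n ih =>
    have h1 : ∑ i ∈ Finset.range (n + 1), (i + 1) * (n + 1 - i)
        = ∑ i ∈ Finset.range (n + 1), (i + 1) * (n - i) + ∑ i ∈ Finset.range (n + 1), (i + 1) := by
      rw [← Finset.sum_add_distrib]
      refine Finset.sum_congr rfl fun i hi => ?_
      rw [show n + 1 - i = n - i + 1 by have := Finset.mem_range.1 hi; omega]
      ring
    have h2 : 2 * ∑ i ∈ Finset.range (n + 1), (i + 1) = (n + 1) * (n + 2) := by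
      have := Finset.sum_range_id_mul_two (n + 2)
      rw [Finset.sum_range_succ'] at this
      simp only [add_zero] at this
      rw [mul_comm, this, mul_comm]
      rfl
    rw [h1, Finset.sum_range_succ, Nat.sub_self, mul_zero, add_zero, mul_add, ih]
    linear_combination 3 * h2

lemma six_mul_pComplexity_le (n : ℕ) :
    6 * pComplexity n ≤ (n + 1) * (n + 2) * (n + 3) := by
  have hsub : {u : List Bool | u.length = n ∧ ∃ l k, 1 ≤ l ∧ k ≤ l ∧ u <:+: Bblk l k} ⊆
      ((Finset.range (n + 1)).biUnion fun s =>
        (suffixes s ×ˢ suffixes (n - s)).image fun x => x.1 ++ flip x.2 : Finset (List Bool)) := by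
    rintro u ⟨rfl, l, k, hl, hk, hu⟩
    obtain ⟨x, hx, y, hy, rfl⟩ := exists_split hl hk hu
    simp only [Finset.coe_biUnion, Set.mem_iUnion, Finset.mem_coe, Finset.mem_image,
      Finset.mem_product, Finset.mem_range]
    refine ⟨x.length, by simp, (x, flip y), ⟨hx, ?_⟩, by simp⟩
    simpa using hy
  have h1 := Set.ncard_le_ncard hsub (Finset.finite_toSet _)
  rw [Set.ncard_coe_finset] at h1
  have h2 := sum_mul_reflect (n + 1)
  refine (Nat.mul_le_mul_left 6 (h1.trans (Finset.card_biUnion_le.trans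
    (Finset.sum_le_sum fun s hs => ?_)))).trans h2.le
  refine Finset.card_image_le.trans ?_
  rw [Finset.card_product]
  refine Nat.mul_le_mul (card_suffixes_le s) ((card_suffixes_le _).trans ?_)
  have := Finset.mem_range.1 hs
  omega

/-! ### Lower bound -/

lemma replicate_infix_append_cons {r : ℕ} {c d : Bool} (hcd : c ≠ d) {u v : List Bool}
    (h : List.replicate r c <:+: u ++ d :: v) :
    List.replicate r c <:+: u ∨ List.replicate r c <:+: v := by
  rw [List.infix_append_iff] at h
  rcases h with h | h | ⟨x, y, hxy, hx, hy⟩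
  · exact Or.inl h
  · rcases List.infix_cons_iff.1 h with h | h
    · rcases List.prefix_cons_iff.1 h with h | ⟨t, ht, _⟩
      · exact Or.inl (h ▸ List.nil_suffix.isInfix)
      · exact absurd (List.eq_of_mem_replicate (n := r) (a := c) (b := d) (by simp [ht])).symm hcd
    · exact Or.inr h
  · rcases List.prefix_cons_iff.1 hy with rfl | ⟨t, rfl, _⟩
    · rw [hxy, List.append_nil]; exact Or.inl hx.isInfix
    · exact absurd (List.eq_of_mem_replicate (n := r) (a := c) (b := d) (by simp [hxy])).symm hcd

lemma Bblk_two_succ (p : ℕ) :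
    Bblk (p + 1 + 2) 2 = Bblk (p + 2) 2 ++ true :: List.replicate (p + 1) false := by
  rw [← Bblk_one, ← Bblk_succ_succ (by omega)]

lemma not_replicate_false_infix_Bblk_two (p : ℕ) :
    ¬ List.replicate (p + 1) false <:+: Bblk (p + 2) 2 := by
  induction p with
  | zero => decide
  | succ p ih =>
    rw [Bblk_two_succ]
    intro h
    rcases replicate_infix_append_cons (by decide) h with h | h
    · exact ih (List.IsInfix.trans ⟨[], [false], by simp [List.replicate_succ']⟩ h)
    · simpa using h.length_le

lemma not_replicate_true_infix_Bblk_two (p : ℕ) :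
    ¬ List.replicate 3 true <:+: Bblk (p + 2) 2 := by
  induction p with
  | zero => decide
  | succ p ih =>
    rcases Nat.eq_zero_or_pos p with rfl | hp
    · decide
    obtain ⟨p, rfl⟩ : ∃ p', p = p' + 1 := ⟨p - 1, by omega⟩
    rw [Bblk_two_succ]
    rw [Bblk_two_succ] at ih ⊢
    intro h
    rw [List.replicate_succ (n := p + 1)] at h
    rw [show ∀ x y z : List Bool, x ++ y ++ (true :: false :: z) = (x ++ y ++ [true]) ++ false :: z
      by simp] at h
    rcases replicate_infix_append_cons (by decide) h with h | h
    · rw [List.replicate_succ' (n := p), show ∀ x y : List Bool, x ++ true :: (y ++ [false])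
        ++ [true] = (x ++ true :: y) ++ false :: [true] by simp] at h
      rcases replicate_infix_append_cons (by decide) h with h | h
      · refine ih (h.trans ⟨[], [false], ?_⟩)
        simp [List.replicate_succ' (n := p)]
      · simpa using h.length_le
    · have := h.subset (a := true) (by simp)
      simp at this


lemma replicate_infix_replicate {m n : ℕ} (h : m ≤ n) (c : Bool) :
    List.replicate m c <:+: List.replicate n c :=
  ⟨[], List.replicate (n - m) c, by simp; omega⟩

/-- The factorization `u ++ v` ends with `p` letters `a` on the left and starts with `q` letters
`b` on the right, and these are the longest constant runs of the word. -/
structure IsJunction (p q : ℕ) (u v : List Bool) : Prop where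
  suffix_left : List.replicate p false <:+ u
  prefix_right : List.replicate q true <+: v
  left_false : ¬ List.replicate (p + 1) false <:+: u
  left_true : ¬ List.replicate 3 true <:+: u
  right_true : ¬ List.replicate (q + 1) true <:+: v
  right_false : ¬ List.replicate 3 false <:+: v

namespace IsJunction

variable {p q p' q' : ℕ} {u v u' v' : List Bool}

lemma exists_right_eq_cons (h : IsJunction p q u v) (hq : 3 ≤ q) : ∃ t, v = true :: t := by
  obtain ⟨t, rfl⟩ := h.prefix_right
  obtain ⟨q, rfl⟩ : ∃ r, q = r + 1 := ⟨q - 1, by omega⟩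
  exact ⟨_, by rw [List.replicate_succ]; rfl⟩

lemma flip_swap (h : IsJunction p q u v) : IsJunction q p (flip v) (flip u) where
  suffix_left := by simpa using flip_suffix_flip h.prefix_right
  prefix_right := by simpa using flip_prefix_flip h.suffix_left
  left_false := fun h' => h.right_true (by simpa using flip_infix_flip h')
  left_true := fun h' => h.right_false (by simpa [-List.reduceReplicate] using flip_infix_flip h')
  right_true := fun h' => h.left_false (by simpa using flip_infix_flip h')
  right_false := fun h' => h.left_true (by simpa [-List.reduceReplicate] using flip_infix_flip h')

lemma left_run_le (h : IsJunction p q u v) (h' : IsJunction p' q' u' v') (hp : 3 ≤ p)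
    (hq : 3 ≤ q) (e : u ++ v = u' ++ v') : p' ≤ p := by
  by_contra! hlt
  have h1 : List.replicate (p + 1) false <:+: u ++ v := by
    rw [e]
    exact (replicate_infix_replicate hlt false).trans
      (h'.suffix_left.isInfix.trans (List.prefix_append _ _).isInfix)
  obtain ⟨t, ht⟩ := h.exists_right_eq_cons hq
  rw [ht] at h1
  rcases replicate_infix_append_cons (by decide) h1 with h1 | h1
  · exact h.left_false h1
  · refine h.right_false ((replicate_infix_replicate (by omega) false).trans (h1.trans ?_))
    rw [ht]
    exact (List.suffix_cons _ _).isInfix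

lemma left_run_eq (h : IsJunction p q u v) (h' : IsJunction p' q' u' v') (hp : 3 ≤ p)
    (hq : 3 ≤ q) (hp' : 3 ≤ p') (hq' : 3 ≤ q') (e : u ++ v = u' ++ v') : p = p' :=
  le_antisymm (h'.left_run_le h hp' hq' e.symm) (h.left_run_le h' hp hq e)

lemma right_run_eq (h : IsJunction p q u v) (h' : IsJunction p' q' u' v') (hp : 3 ≤ p)
    (hq : 3 ≤ q) (hp' : 3 ≤ p') (hq' : 3 ≤ q') (e : u ++ v = u' ++ v') : q = q' :=
  h.flip_swap.left_run_eq h'.flip_swap hq hp hq' hp' (by rw [← flip_append, e, flip_append])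

lemma length_left_le (h : IsJunction p q u v) (h' : IsJunction p' q' u' v') (hq : 3 ≤ q)
    (hp' : 3 ≤ p') (e : u ++ v = u' ++ v') : u'.length ≤ u.length := by
  by_contra! hlt
  obtain ⟨t, rfl⟩ := List.prefix_of_prefix_length_le (List.prefix_append u v)
    (e ▸ List.prefix_append u' v') hlt.le
  rw [List.append_assoc, List.append_cancel_left_eq] at e
  obtain ⟨r, hr⟩ := h.exists_right_eq_cons hq
  rcases t with _ | ⟨c, t⟩
  · simp at hlt
  obtain rfl : true = c := by
    rw [hr] at e
    simpa using congrArg List.head? e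
  rcases List.suffix_or_suffix_of_suffix h'.suffix_left (List.suffix_append u (true :: t))
    with h1 | h1
  · refine h.right_false ((replicate_infix_replicate hp' false).trans (h1.isInfix.trans ?_))
    rw [e]
    exact (List.prefix_append _ _).isInfix
  · simpa using h1.subset (a := true) (by simp)

lemma length_left_eq (h : IsJunction p q u v) (h' : IsJunction p' q' u' v') (hp : 3 ≤ p)
    (hq : 3 ≤ q) (hp' : 3 ≤ p') (hq' : 3 ≤ q') (e : u ++ v = u' ++ v') : u.length = u'.length :=
  le_antisymm (h'.length_left_le h hq' hp e.symm) (h.length_left_le h' hq hp' e)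

end IsJunction

/-- The suffix of length `s` of the block `B(p + 2, 2)`. -/
def leftPart (p s : ℕ) : List Bool :=
  (Bblk (p + 2) 2).drop ((Bblk (p + 2) 2).length - s)

/-- The prefix of length `t` of the block `B(q + 2, q)`. -/
def rightPart (q t : ℕ) : List Bool := flip (leftPart q t)

lemma leftPart_suffix_Bblk (p s : ℕ) : leftPart p s <:+ Bblk (p + 2) 2 := List.drop_suffix _ _

lemma rightPart_prefix_Bblk (q t : ℕ) : rightPart q t <+: Bblk (q + 2) q := by
  rw [← flip_Bblk (by omega)]
  exact flip_prefix_flip (leftPart_suffix_Bblk q t)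

lemma length_leftPart {p s : ℕ} (h : 2 * s ≤ p * p) : (leftPart p s).length = s := by
  have h1 : p * p ≤ 2 * (p + 2).choose 2 := by
    rw [Nat.choose_two_right, Nat.mul_div_cancel' (Nat.even_mul_pred_self _).two_dvd]
    exact Nat.mul_le_mul (by omega) (by omega)
  rw [leftPart, List.length_drop, length_Bblk (by omega) (by omega)]
  omega

lemma isJunction_parts {p q s t : ℕ} (hp : 3 ≤ p) (hq : 3 ≤ q) (hs : 2 * s ≤ p * p)
    (ht : 2 * t ≤ q * q) (hps : p ≤ s) (hqt : q ≤ t) :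
    IsJunction p q (leftPart p s) (rightPart q t) := by
  have suf : ∀ {p s : ℕ}, 3 ≤ p → 2 * s ≤ p * p → p ≤ s →
      List.replicate p false <:+ leftPart p s := fun hp hs hps =>
    List.suffix_of_suffix_length_le (replicate_suffix_Bblk (by omega) (by omega))
      (leftPart_suffix_Bblk _ _) (by rw [length_leftPart hs]; simpa)
  have left {p : ℕ} {s : ℕ} : leftPart p s <:+: Bblk (p + 2) 2 := (leftPart_suffix_Bblk p s).isInfix
  refine ⟨suf hp hs hps, ?_, fun h => ?_, fun h => ?_, fun h => ?_, fun h => ?_⟩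
  · simpa [rightPart] using flip_prefix_flip (suf hq ht hqt)
  · exact not_replicate_false_infix_Bblk_two p (h.trans left)
  · exact not_replicate_true_infix_Bblk_two p (h.trans left)
  · exact not_replicate_false_infix_Bblk_two q
      (List.IsInfix.trans (by simpa [rightPart, -List.reduceReplicate] using flip_infix_flip h) left)
  · exact not_replicate_true_infix_Bblk_two q
      (List.IsInfix.trans (by simpa [rightPart, -List.reduceReplicate] using flip_infix_flip h) left)

lemma parts_infix_Bblk {p q : ℕ} (hp : 1 ≤ p) (hq : 1 ≤ q) (s t : ℕ) :
    leftPart p s ++ rightPart q t <:+: Bblk (p + q + 2) (q + 1) := by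
  rw [Bblk_succ_succ (by omega)]
  have h1 : leftPart p s <:+ Bblk (p + q + 1) (q + 1) :=
    (leftPart_suffix_Bblk p s).trans (Bblk_suffix hp (show 2 ≤ q + 1 by omega))
  have h2 : rightPart q t <+: Bblk (p + q + 1) q := by
    refine (rightPart_prefix_Bblk q t).trans ?_
    have := flip_prefix_flip (Bblk_suffix (p := q) hq (show 2 ≤ p + 1 by omega))
    rwa [flip_Bblk (by omega), flip_Bblk (by omega),
      show q + (p + 1) = p + q + 1 by omega] at this
  obtain ⟨x, hx⟩ := h1
  obtain ⟨y, hy⟩ := h2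
  exact ⟨x, y, by rw [← hx, ← hy]; simp⟩

lemma le_six_mul_pComplexity {m n : ℕ} (hm : 3 ≤ m) (hmn : 2 * n ≤ m * m) :
    (n - 2 * m - 1) * (n - 2 * m - 1 + 1) * (n - 2 * m - 1 + 2) ≤ 6 * pComplexity n := by
  obtain ⟨r, hr⟩ : ∃ r, r = n - 2 * m - 1 := ⟨_, rfl⟩
  rw [← hr, ← sum_mul_reflect]
  refine Nat.mul_le_mul_left 6 ?_
  let F : Finset (Σ _ : ℕ, ℕ × ℕ) :=
    (Finset.range r).sigma fun i => Finset.range (i + 1) ×ˢ Finset.range (r - i)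
  let f : (Σ _ : ℕ, ℕ × ℕ) → List Bool := fun x =>
    leftPart (m + x.2.1) (m + 1 + x.1) ++ rightPart (m + x.2.2) (n - (m + 1 + x.1))
  have hF : F.card = ∑ i ∈ Finset.range r, (i + 1) * (r - i) := by
    simp [F, Finset.card_sigma]
  have hmem : ∀ x ∈ F, x.1 < r ∧ x.2.1 < x.1 + 1 ∧ x.2.2 < r - x.1 := fun x hx => by
    simpa [F] using hx
  have hsq : ∀ j s : ℕ, s ≤ n → 2 * s ≤ (m + j) * (m + j) := fun j s hs => by nlinarith
  have hjunction : ∀ x ∈ F, IsJunction (m + x.2.1) (m + x.2.2)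
      (leftPart (m + x.2.1) (m + 1 + x.1))
      (rightPart (m + x.2.2) (n - (m + 1 + x.1))) := fun x hx => by
    obtain ⟨h1, h2, h3⟩ := hmem x hx
    exact isJunction_parts (by omega) (by omega) (hsq _ _ (by omega)) (hsq _ _ (by omega))
      (by omega) (by omega)
  have hinj : Set.InjOn f F := by
    rintro ⟨i, j, k⟩ hx ⟨i', j', k'⟩ hx' e
    have h := hjunction _ hx
    have h' := hjunction _ hx'
    have e1 := h.left_run_eq h' (by omega) (by omega) (by omega) (by omega) e
    have e2 := h.right_run_eq h' (by omega) (by omega) (by omega) (by omega) e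
    have e3 := h.length_left_eq h' (by omega) (by omega) (by omega) (by omega) e
    have h1 := hmem _ hx
    have h1' := hmem _ hx'
    rw [length_leftPart (hsq _ _ (by omega)), length_leftPart (hsq _ _ (by omega))] at e3
    simp only at e1 e2 e3
    obtain rfl : i = i' := by omega
    obtain rfl : j = j' := by omega
    obtain rfl : k = k' := by omega
    rfl
  rw [← hF, ← Finset.card_image_of_injOn hinj, ← Set.ncard_coe_finset]
  refine Set.ncard_le_ncard ?_ ((List.finite_length_eq Bool n).subset fun u hu => hu.1)
  intro u hu
  obtain ⟨x, hx, rfl⟩ := Finset.mem_image.1 (Finset.mem_coe.1 hu)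
  obtain ⟨h1, h2, h3⟩ := hmem x hx
  refine ⟨?_, _, _, ?_, ?_, parts_infix_Bblk (by omega) (by omega) _ _⟩
  · rw [List.length_append, rightPart, length_flip, length_leftPart (hsq _ _ (by omega)),
      length_leftPart (hsq _ _ (by omega))]
    omega
  · omega
  · omega

lemma tendsto_sub_sqrt_div :
    Tendsto (fun n : ℕ => ((n - 2 * (Nat.sqrt (2 * n) + 3) - 1 : ℕ) : ℝ) / n) atTop (nhds 1) := by
  have hlow : Tendsto (fun n : ℕ => 1 - 2 * √2 * (√(n : ℝ))⁻¹ - 7 * (n : ℝ)⁻¹) atTop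
      (nhds 1) := by
    have h1 : Tendsto (fun n : ℕ => (√(n : ℝ))⁻¹) atTop (nhds 0) :=
      (Real.tendsto_sqrt_atTop.comp tendsto_natCast_atTop_atTop).inv_tendsto_atTop
    have h2 : Tendsto (fun n : ℕ => (n : ℝ)⁻¹) atTop (nhds 0) :=
      tendsto_natCast_atTop_atTop.inv_tendsto_atTop
    simpa using (tendsto_const_nhds.sub (h1.const_mul (2 * √2))).sub (h2.const_mul 7)
  refine tendsto_of_tendsto_of_tendsto_of_le_of_le' hlow tendsto_const_nhds ?_ ?_
  · filter_upwards [eventually_gt_atTop 0] with n hn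
    have hn' : (0 : ℝ) < n := by exact_mod_cast hn
    have h1 : ((Nat.sqrt (2 * n) : ℕ) : ℝ) ≤ √2 * √n := by
      rw [← Real.sqrt_mul (by norm_num)]
      exact_mod_cast Real.nat_sqrt_le_real_sqrt (a := 2 * n)
    have h2 : (n : ℝ) ≤ (n - 2 * (Nat.sqrt (2 * n) + 3) - 1 : ℕ) +
        2 * (Nat.sqrt (2 * n) + 3) + 1 := by
      exact_mod_cast (by omega)
    have h3 : (√(n : ℝ))⁻¹ = √n / n := by
      rw [inv_eq_one_div, div_eq_div_iff (by positivity) hn'.ne', one_mul,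
        Real.mul_self_sqrt hn'.le]
    rw [le_div_iff₀ hn', h3]
    have : (1 - 2 * √2 * (√(n : ℝ) / n) - 7 * (n : ℝ)⁻¹) * n = n - 2 * (√2 * √n) - 7 := by
      field_simp
    rw [this]
    linarith
  · filter_upwards with n
    exact div_le_one_of_le₀ (by exact_mod_cast (by omega)) (by positivity)

end PascalWords

open PascalWords

/-- The complexity of the Pascal subshift satisfies `p_n / n³ → 1/6`. -/
theorem complexity_asymptotics :
    Tendsto (fun n : ℕ => (pComplexity n : ℝ) / (n : ℝ) ^ 3) atTop (nhds (1 / 6)) := by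
  have hupper : Tendsto (fun n : ℕ => 1 / 6 * ((1 + 1 * (n : ℝ)⁻¹) * (1 + 2 * (n : ℝ)⁻¹) *
      (1 + 3 * (n : ℝ)⁻¹))) atTop (nhds (1 / 6)) := by
    have h : Tendsto (fun n : ℕ => (n : ℝ)⁻¹) atTop (nhds 0) :=
      tendsto_natCast_atTop_atTop.inv_tendsto_atTop
    have h' : ∀ c : ℝ, Tendsto (fun n : ℕ => 1 + c * (n : ℝ)⁻¹) atTop (nhds 1) := fun c => by
      simpa using (h.const_mul c).const_add 1
    have h3 := (((h' 1).mul (h' 2)).mul (h' 3)).const_mul (1 / 6)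
    simp only [mul_one] at h3
    exact h3
  have hlower := (tendsto_sub_sqrt_div.pow 3).const_mul (1 / 6)
  rw [one_pow, mul_one] at hlower
  refine tendsto_of_tendsto_of_tendsto_of_le_of_le' hlower hupper ?_ ?_
  · filter_upwards with n
    have h := le_six_mul_pComplexity (m := Nat.sqrt (2 * n) + 3) (n := n) (by omega)
      (by nlinarith [Nat.lt_succ_sqrt (2 * n)])
    set r := n - 2 * (Nat.sqrt (2 * n) + 3) - 1
    have h1 : r ^ 3 ≤ 6 * pComplexity n := by
      refine le_trans ?_ h
      rw [pow_succ, pow_two]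
      gcongr <;> omega
    have h2 : (r : ℝ) ^ 3 ≤ 6 * pComplexity n := by exact_mod_cast h1
    rw [div_pow, ← mul_div_assoc]
    gcongr
    linarith
  · filter_upwards [eventually_gt_atTop 0] with n hn
    have hn' : (0 : ℝ) < n := by exact_mod_cast hn
    have h : (6 : ℝ) * pComplexity n ≤ (n + 1) * (n + 2) * (n + 3) := by
      exact_mod_cast six_mul_pComplexity_le n
    rw [div_le_iff₀ (by positivity)]
    have : 1 / 6 * ((1 + 1 * (n : ℝ)⁻¹) * (1 + 2 * (n : ℝ)⁻¹) * (1 + 3 * (n : ℝ)⁻¹)) * (n : ℝ) ^ 3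
        = 1 / 6 * ((n + 1) * (n + 2) * (n + 3)) := by
      field_simp
    rw [this]
    linarith
end

section
/- (Occurrence counts, telltale case) Let u be a word in the language L(ζ) that appears for the first time in B(n₀,k₀) — meaning u is an infix of B(n₀,k₀) but u is not an infix of any B(n,k) with (n,k) ≠ (n₀,k₀), k ≤ k₀ and n−k ≤ n₀−k₀ — where 2 ≤ k₀ ≤ n₀−2, and suppose the telltale word b a^{n₀−k₀−1} b^{k₀−1} a is an infix of u. Then for all integers i ≥ 0 and 0 ≤ j ≤ i, the number of occurrences of u in B(n₀+i, k₀+j) equals C(i, j); i.e., the triangle of appearances of u is the Pascal triangle. -/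
/-- The number of occurrences of `u` in `w`. -/
def occ (u w : List Bool) : ℕ :=
  ((Finset.range (w.length - u.length + 1)).filter
    (fun i => (w.drop i).take u.length = u)).card

/-- The telltale word `b a^m b^r a`. -/
def telltale (m r : ℕ) : List Bool :=
  true :: (List.replicate m false ++ (List.replicate r true ++ [false]))

theorem length_telltale (m r : ℕ) : (telltale m r).length = m + r + 2 := by
  simp [telltale]
  omega

theorem telltale_getElem? (m r k : ℕ) :
    (telltale m r)[k]? =
      if k = 0 then some true else if k ≤ m then some false
      else if k ≤ m + r then some true else if k = m + r + 1 then some false else none := by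
  cases k with
  | zero => simp [telltale]
  | succ k => simp only [telltale]; grind

theorem telltale_ne_nil (m r : ℕ) : telltale m r ≠ [] := by simp [telltale]

/-- The only way a telltale word can straddle the border of two consecutive blocks. -/
theorem telltale_straddle {M R m r i : ℕ} {l s : List Bool} (hM : 1 ≤ M) (hR : 1 ≤ R)
    (hl : m = 0 → l = []) (hs : r = 0 → s = [])
    (h : telltale M R <+: (l ++ telltale m r ++ s).drop i)
    (h₁ : i < l.length + (m + 1)) (h₂ : l.length + (m + 1) < i + (M + R + 2)) :
    m = M ∧ r = R ∧ i = l.length := by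
  have hT : ∀ k, k ≤ M + R + 1 →
      (l ++ telltale m r ++ s)[i + k]? = (telltale M R)[k]? := by
    intro k hk
    obtain ⟨t, ht⟩ := h
    rw [← List.getElem?_drop, ← ht, List.getElem?_append_left]
    rw [length_telltale]; omega
  have hW : ∀ k, k ≤ m + r + 1 →
      (l ++ telltale m r ++ s)[l.length + k]? = (telltale m r)[k]? := by
    intro k hk
    rw [List.append_assoc, List.getElem?_append_right (by omega), Nat.add_sub_cancel_left,
      List.getElem?_append_left]
    rw [length_telltale]; omega
  have key : ∀ x y, x ≤ M + R + 1 → y ≤ m + r + 1 → i + x = l.length + y →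
      (telltale M R)[x]? = (telltale m r)[y]? := by
    intro x y hx hy hxy
    rw [← hT x hx, ← hW y hy, hxy]
  simp only [telltale_getElem?] at key
  have hlen : i + (M + R + 2) ≤ l.length + (m + r + 2) + s.length := by
    have := h.length_le
    simp only [List.length_drop, List.length_append, length_telltale] at this
    omega
  have hi : i = l.length := by
    rcases lt_trichotomy i l.length with hlt | heq | hgt
    · have hm : m ≠ 0 := fun h0 => by simp [hl h0] at hlt
      have a := key (l.length - i) 0 (by omega) (by omega) (by omega)
      have b := key (l.length - i + 1) 1 (by omega) (by omega) (by omega)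
      grind
    · exact heq
    · have a := key 0 (i - l.length) (by omega) (by omega) (by omega)
      grind
  have hm : m = M := by
    rcases lt_trichotomy m M with hlt | heq | hgt
    · have hr : r ≠ 0 := fun h0 => by
        simp [hs h0] at hlen
        omega
      have a := key (m + 1) (m + 1) (by omega) (by omega) (by omega)
      grind
    · exact heq
    · have a := key (M + 1) (M + 1) (by omega) (by omega) (by omega)
      grind
  subst hm
  refine ⟨rfl, ?_, hi⟩
  rcases lt_trichotomy r R with hlt | heq | hgt
  · have a := key (m + r + 1) (m + r + 1) (by omega) (by omega) (by omega)
    grind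
  · exact heq
  · have a := key (m + R + 1) (m + R + 1) (by omega) (by omega) (by omega)
    grind

/-- The basic block `B(p + q, q)`. -/
def pqBlock (p q : ℕ) : List Bool := Bblk (p + q) q

theorem pqBlock_zero_left (q : ℕ) : pqBlock 0 q = [true] := by
  cases q <;> simp [pqBlock, Bblk]

theorem pqBlock_zero_right (p : ℕ) : pqBlock (p + 1) 0 = [false] := by
  simp [pqBlock, Bblk]

theorem pqBlock_succ_succ (p q : ℕ) :
    pqBlock (p + 1) (q + 1) = pqBlock p (q + 1) ++ pqBlock (p + 1) q := by
  have h : p + 1 + q = p + (q + 1) := by omega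
  simp only [pqBlock, h]
  rw [show p + 1 + (q + 1) = (p + (q + 1)) + 1 by omega, Bblk, if_neg (by omega)]

theorem pqBlock_eq_append_replicate (p q : ℕ) :
    ∃ l, pqBlock p (q + 1) = l ++ true :: List.replicate p false ∧ (p = 0 → l = []) := by
  induction q generalizing p with
  | zero =>
    refine ⟨[], ?_, fun _ => rfl⟩
    induction p with
    | zero => simp [pqBlock_zero_left]
    | succ p ih => simp [pqBlock_succ_succ, ih, pqBlock_zero_right, List.replicate_succ']
  | succ q ih =>
    cases p with
    | zero => exact ⟨[], by simp [pqBlock_zero_left], fun _ => rfl⟩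
    | succ p =>
      obtain ⟨l, hl, -⟩ := ih (p + 1)
      exact ⟨pqBlock p (q + 2) ++ l, by rw [pqBlock_succ_succ, hl, List.append_assoc], by simp⟩

theorem pqBlock_eq_replicate_append (p q : ℕ) :
    ∃ s, pqBlock (p + 1) q = List.replicate q true ++ [false] ++ s ∧ (q = 0 → s = []) := by
  induction p generalizing q with
  | zero =>
    refine ⟨[], ?_, fun _ => rfl⟩
    induction q with
    | zero => simp [pqBlock_zero_right]
    | succ q ih => simpa [pqBlock_succ_succ, pqBlock_zero_left, List.replicate_succ] using ih
  | succ p ih =>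
    cases q with
    | zero => exact ⟨[], by simp [pqBlock_zero_right], fun _ => rfl⟩
    | succ q =>
      obtain ⟨s, hs, -⟩ := ih (q + 1)
      exact ⟨s ++ pqBlock (p + 2) q, by rw [pqBlock_succ_succ, hs, List.append_assoc], by simp⟩

/-- The position of the telltale word that straddles the middle of `pqBlock (m + 1) (r + 1)`. -/
def midPos (m r : ℕ) : ℕ := (pqBlock m (r + 1)).length - (m + 1)

theorem telltale_prefix_drop_midPos (m r : ℕ) :
    telltale m r <+: (pqBlock (m + 1) (r + 1)).drop (midPos m r) ∧
      midPos m r < (pqBlock m (r + 1)).length := by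
  obtain ⟨l, hl, -⟩ := pqBlock_eq_append_replicate m r
  obtain ⟨s, hs, -⟩ := pqBlock_eq_replicate_append m r
  have hmid : midPos m r = l.length := by simp [midPos, hl]
  refine ⟨?_, by simp [hmid, hl]⟩
  rw [pqBlock_succ_succ, hmid, hl, hs, List.append_assoc, List.drop_left]
  exact ⟨s, by simp [telltale]⟩

theorem prefix_drop_append_left_iff {T L R : List Bool} {i : ℕ} (h : i + T.length ≤ L.length) :
    T <+: (L ++ R).drop i ↔ T <+: L.drop i := by
  rw [List.drop_append_of_le_length (by omega)]
  refine ⟨fun h' => ?_, fun h' => h'.trans (List.prefix_append _ _)⟩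
  exact List.prefix_of_prefix_length_le h' (List.prefix_append _ _)
    (by rw [List.length_drop]; omega)

theorem prefix_drop_length_le {T L : List Bool} {i : ℕ} (hT : T ≠ []) (h : T <+: L.drop i) :
    i + T.length ≤ L.length := by
  have := h.length_le
  have := List.length_pos_of_ne_nil hT
  rw [List.length_drop] at *
  omega

theorem telltale_prefix_drop_pqBlock {M R p q i : ℕ} (hM : 1 ≤ M) (hR : 1 ≤ R)
    (hi : i < (pqBlock p (q + 1)).length) :
    telltale M R <+: (pqBlock (p + 1) (q + 1)).drop i ↔
      telltale M R <+: (pqBlock p (q + 1)).drop i ∨ p = M ∧ q = R ∧ i = midPos M R := by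
  constructor
  · intro h
    by_cases hle : i + (telltale M R).length ≤ (pqBlock p (q + 1)).length
    · left
      rwa [pqBlock_succ_succ, prefix_drop_append_left_iff hle] at h
    · right
      obtain ⟨l, hl, hl0⟩ := pqBlock_eq_append_replicate p q
      obtain ⟨s, hs, hs0⟩ := pqBlock_eq_replicate_append p q
      have hmid : midPos p q = l.length := by simp [midPos, hl]
      have hW : pqBlock (p + 1) (q + 1) = l ++ telltale p q ++ s := by
        simp [pqBlock_succ_succ, hl, hs, telltale]
      rw [hW] at h
      simp only [hl, length_telltale, List.length_append, List.length_cons,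
        List.length_replicate] at hi hle
      obtain ⟨rfl, rfl, h3⟩ := telltale_straddle hM hR hl0 hs0 h hi (by omega)
      exact ⟨rfl, rfl, by omega⟩
  · rintro (h | ⟨rfl, rfl, rfl⟩)
    · rwa [pqBlock_succ_succ,
        prefix_drop_append_left_iff (prefix_drop_length_le (telltale_ne_nil _ _) h)]
    · exact (telltale_prefix_drop_midPos p q).1

theorem not_telltale_prefix_drop_of_length_le_one {M R i : ℕ} {w : List Bool}
    (hw : w.length ≤ 1) : ¬ telltale M R <+: w.drop i := by
  intro h
  have := prefix_drop_length_le (telltale_ne_nil _ _) h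
  rw [length_telltale] at this
  omega

theorem length_pqBlock_zero_left (q : ℕ) : (pqBlock 0 q).length ≤ 1 := by
  simp [pqBlock_zero_left]

theorem length_pqBlock_zero_right (p : ℕ) : (pqBlock p 0).length ≤ 1 := by
  cases p <;> simp [pqBlock_zero_left, pqBlock_zero_right]

/-- Every occurrence of a telltale word in a block is the middle one of an occurrence of the
block `pqBlock (M + 1) (R + 1)`. -/
theorem exists_pqBlock_prefix_of_telltale {M R : ℕ} (hM : 1 ≤ M) (hR : 1 ≤ R) (p q : ℕ) {i : ℕ}
    (h : telltale M R <+: (pqBlock p q).drop i) :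
    ∃ i', i = i' + midPos M R ∧ pqBlock (M + 1) (R + 1) <+: (pqBlock p q).drop i' := by
  induction p generalizing q i with
  | zero => exact absurd h (not_telltale_prefix_drop_of_length_le_one (length_pqBlock_zero_left q))
  | succ p ihp =>
    induction q generalizing i with
    | zero =>
      exact absurd h (not_telltale_prefix_drop_of_length_le_one (length_pqBlock_zero_right _))
    | succ q ihq =>
      by_cases hi : i < (pqBlock p (q + 1)).length
      · rcases (telltale_prefix_drop_pqBlock hM hR hi).1 h with h | ⟨rfl, rfl, rfl⟩
        · obtain ⟨i', rfl, hi'⟩ := ihp _ h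
          refine ⟨i', rfl, ?_⟩
          rw [pqBlock_succ_succ p q, List.drop_append_of_le_length (by omega)]
          exact hi'.trans (List.prefix_append _ _)
        · exact ⟨0, by simp, by simp⟩
      · obtain ⟨k, rfl⟩ := Nat.exists_eq_add_of_le (not_lt.1 hi)
        rw [pqBlock_succ_succ p q] at h ⊢
        rw [List.drop_length_add_append] at h
        obtain ⟨i', rfl, hi'⟩ := ihq h
        exact ⟨(pqBlock p (q + 1)).length + i', by omega, by rwa [List.drop_length_add_append]⟩

theorem take_drop_eq_self_iff {u w : List Bool} {i : ℕ} :
    (w.drop i).take u.length = u ↔ u <+: w.drop i := by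
  rw [List.prefix_iff_eq_take, eq_comm]

theorem occ_eq_card {u w : List Bool} (hu : u ≠ []) :
    occ u w = ((Finset.range w.length).filter (fun i => u <+: w.drop i)).card := by
  unfold occ
  congr 1
  ext i
  simp only [Finset.mem_filter, Finset.mem_range, take_drop_eq_self_iff]
  refine and_congr_left fun h => ?_
  have := prefix_drop_length_le hu h
  have := List.length_pos_of_ne_nil hu
  omega

theorem occ_telltale_of_length_le_one {M R : ℕ} {w : List Bool} (hw : w.length ≤ 1) :
    occ (telltale M R) w = 0 := by
  rw [occ_eq_card (telltale_ne_nil _ _), Finset.card_eq_zero, Finset.filter_eq_empty_iff]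
  exact fun i _ => not_telltale_prefix_drop_of_length_le_one hw

theorem occ_telltale_succ_succ {M R : ℕ} (hM : 1 ≤ M) (hR : 1 ≤ R) (p q : ℕ) :
    occ (telltale M R) (pqBlock (p + 1) (q + 1)) =
      occ (telltale M R) (pqBlock p (q + 1)) + occ (telltale M R) (pqBlock (p + 1) q) +
        if p = M ∧ q = R then 1 else 0 := by
  simp only [occ_eq_card (telltale_ne_nil M R), Finset.card_filter]
  have hlen : (pqBlock (p + 1) (q + 1)).length =
      (pqBlock p (q + 1)).length + (pqBlock (p + 1) q).length := by
    rw [pqBlock_succ_succ, List.length_append]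
  rw [hlen, Finset.sum_range_add]
  have h₂ : ∀ x, (pqBlock (p + 1) (q + 1)).drop ((pqBlock p (q + 1)).length + x) =
      (pqBlock (p + 1) q).drop x := by
    intro x
    rw [pqBlock_succ_succ, List.drop_length_add_append]
  simp only [h₂]
  rw [add_right_comm]
  congr 1
  have h₁ : ∀ i ∈ Finset.range (pqBlock p (q + 1)).length,
      (if telltale M R <+: (pqBlock (p + 1) (q + 1)).drop i then 1 else 0) =
        (if telltale M R <+: (pqBlock p (q + 1)).drop i then 1 else 0) +
          if i = midPos M R then (if p = M ∧ q = R then 1 else 0) else 0 := by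
    intro i hi
    have h := telltale_prefix_drop_pqBlock hM hR (Finset.mem_range.1 hi)
    have hexcl : telltale M R <+: (pqBlock p (q + 1)).drop i →
        ¬ (p = M ∧ q = R ∧ i = midPos M R) := by
      rintro h' ⟨rfl, rfl, rfl⟩
      have := prefix_drop_length_le (telltale_ne_nil _ _) h'
      rw [length_telltale] at this
      unfold midPos at this
      omega
    grind
  rw [Finset.sum_congr rfl h₁, Finset.sum_add_distrib, Finset.sum_ite_eq']
  congr 1
  split_ifs with h h' h'
  · rfl
  · rfl
  · obtain ⟨rfl, rfl⟩ := h'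
    exact absurd (Finset.mem_range.2 (telltale_prefix_drop_midPos p q).2) h
  · rfl

theorem occ_telltale_eq_zero {M R : ℕ} (hM : 1 ≤ M) (hR : 1 ≤ R) (p q : ℕ)
    (h : p ≤ M ∨ q ≤ R) : occ (telltale M R) (pqBlock p q) = 0 := by
  induction p generalizing q with
  | zero => exact occ_telltale_of_length_le_one (length_pqBlock_zero_left q)
  | succ p ihp =>
    induction q with
    | zero => exact occ_telltale_of_length_le_one (length_pqBlock_zero_right _)
    | succ q ihq =>
      rw [occ_telltale_succ_succ hM hR, ihp _ (by omega), ihq (by omega), if_neg (by omega)]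

theorem occ_telltale_pqBlock {M R : ℕ} (hM : 1 ≤ M) (hR : 1 ≤ R) (s t : ℕ) :
    occ (telltale M R) (pqBlock (M + 1 + s) (R + 1 + t)) = (s + t).choose t := by
  induction s generalizing t with
  | zero =>
    induction t with
    | zero =>
      simp [occ_telltale_succ_succ hM hR, occ_telltale_eq_zero hM hR M (R + 1) (by omega),
        occ_telltale_eq_zero hM hR (M + 1) R (by omega)]
    | succ t iht =>
      rw [add_zero, ← add_assoc (R + 1), occ_telltale_succ_succ hM hR,
        occ_telltale_eq_zero hM hR M _ (by omega), if_neg (by omega)]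
      simpa using iht
  | succ s ihs =>
    induction t with
    | zero =>
      have := ihs 0
      rw [← add_assoc (M + 1), add_zero, occ_telltale_succ_succ hM hR,
        occ_telltale_eq_zero hM hR _ R (by omega), if_neg (by omega)]
      simpa using this
    | succ t iht =>
      have := ihs (t + 1)
      rw [← add_assoc (M + 1), ← add_assoc (R + 1), occ_telltale_succ_succ hM hR,
        if_neg (by omega), add_assoc (R + 1) t 1, this, add_assoc (M + 1) s 1, iht,
        show s + 1 + (t + 1) = (s + t + 1) + 1 by omega, Nat.choose_succ_succ',
        show s + 1 + t = s + t + 1 by omega, show s + (t + 1) = s + t + 1 by omega]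
      omega

theorem prefix_drop_add {x u y w : List Bool} {i : ℕ} (h : x ++ u ++ y <+: w.drop i) :
    u <+: w.drop (i + x.length) := by
  obtain ⟨t, ht⟩ := h
  exact ⟨y ++ t, by rw [← List.drop_drop, ← ht]; simp⟩

/-- A subword of `pqBlock (M + 1) (R + 1)` containing the telltale word occurs in each block
exactly as often as the telltale word. -/
theorem occ_eq_occ_telltale {M R : ℕ} (hM : 1 ≤ M) (hR : 1 ≤ R) {u : List Bool}
    (hu : u <:+: pqBlock (M + 1) (R + 1)) (ht : telltale M R <:+: u) (p q : ℕ) :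
    occ u (pqBlock p q) = occ (telltale M R) (pqBlock p q) := by
  obtain ⟨x, y, hxy⟩ := ht
  obtain ⟨c, d, hcd⟩ := hu
  have hune : u ≠ [] := by
    rintro rfl
    simp [telltale] at hxy
  have hmid : c.length + x.length = midPos M R := by
    have h : telltale M R <+: (pqBlock (M + 1) (R + 1)).drop ((c ++ x).length) := by
      have := prefix_drop_add (x := c ++ x) (u := telltale M R) (y := y ++ d)
        (w := pqBlock (M + 1) (R + 1)) (i := 0) (by simp [← hcd, ← hxy])
      simpa using this
    obtain ⟨i', hi', hpre⟩ := exists_pqBlock_prefix_of_telltale hM hR _ _ h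
    have hne : pqBlock (M + 1) (R + 1) ≠ [] := by
      rw [← hcd]
      simp [hune]
    have := prefix_drop_length_le hne hpre
    rw [List.length_append] at hi'
    omega
  rw [occ_eq_card hune, occ_eq_card (telltale_ne_nil M R)]
  refine Finset.card_bij (fun i _ => i + x.length) ?_ ?_ ?_
  · intro i hi
    simp only [Finset.mem_filter, Finset.mem_range] at hi ⊢
    have h : telltale M R <+: (pqBlock p q).drop (i + x.length) :=
      prefix_drop_add (y := y) (by rw [hxy]; exact hi.2)
    have := prefix_drop_length_le (telltale_ne_nil _ _) h
    rw [length_telltale] at this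
    exact ⟨by omega, h⟩
  · intro i _ j _ hij
    exact Nat.add_right_cancel hij
  · intro i hi
    simp only [Finset.mem_filter, Finset.mem_range] at hi
    obtain ⟨i', rfl, hpre⟩ := exists_pqBlock_prefix_of_telltale hM hR _ _ hi.2
    rw [← hcd] at hpre
    refine ⟨i' + c.length, ?_, by omega⟩
    simp only [Finset.mem_filter, Finset.mem_range]
    exact ⟨by omega, prefix_drop_add hpre⟩

/-- Occurrence counts in the telltale case: if `u` appears for the first time
in `B(n₀,k₀)` (with `2 ≤ k₀ ≤ n₀ − 2`) and contains the telltale word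
`b a^{n₀−k₀−1} b^{k₀−1} a`, then the triangle of appearances of `u` is the
Pascal triangle: `u` occurs exactly `C(i,j)` times in `B(n₀+i, k₀+j)`. -/
theorem occurrences_telltale_case (u : List Bool) (n₀ k₀ : ℕ)
    (hk₀ : 2 ≤ k₀) (hn₀ : k₀ + 2 ≤ n₀)
    (hu : u <:+: Bblk n₀ k₀)
    (hfirst : ∀ n k, 1 ≤ n → k ≤ n → (n, k) ≠ (n₀, k₀) →
      k ≤ k₀ → n - k ≤ n₀ - k₀ → ¬ u <:+: Bblk n k)
    (htell : ([true] ++ List.replicate (n₀ - k₀ - 1) false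
        ++ List.replicate (k₀ - 1) true ++ [false]) <:+: u) :
    ∀ i : ℕ, ∀ j ≤ i, occ u (Bblk (n₀ + i) (k₀ + j)) = Nat.choose i j := by
  intro i j hj
  obtain ⟨M, hM⟩ := Nat.exists_eq_add_of_le hn₀
  obtain ⟨R, rfl⟩ := Nat.exists_eq_add_of_le' hk₀
  obtain ⟨s, rfl⟩ := Nat.exists_eq_add_of_le' hj
  subst hM
  rw [show R + 2 + 2 + M - (R + 2) - 1 = M + 1 by omega, show R + 2 - 1 = R + 1 by omega] at htell
  have ht : telltale (M + 1) (R + 1) <:+: u := by simpa [telltale] using htell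
  have hu' : u <:+: pqBlock (M + 1 + 1) (R + 1 + 1) := by
    unfold pqBlock
    convert hu using 2
    omega
  have hB : Bblk (R + 2 + 2 + M + (s + j)) (R + 2 + j) =
      pqBlock (M + 1 + 1 + s) (R + 1 + 1 + j) := by
    unfold pqBlock
    congr 1
    omega
  rw [hB, occ_eq_occ_telltale (by omega) (by omega) hu' ht,
    occ_telltale_pqBlock (by omega) (by omega)]
end

section
/- (Topological weak mixing of the Pascal subshift) The subshift (Σ, σ) is topologically weakly mixing: the product system (Σ × Σ, σ × σ) is topologically transitive, i.e., for all nonempty open subsets U, V of Σ × Σ (in the product topology) there exists an integer N ≥ 1 such that the image of U under the N-th iterate of σ × σ intersects V. -/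
/-- The Pascal subshift `Σ`: bi-infinite sequences all of whose finite
subwords are infixes of basic blocks. -/
def Sig : Set (ℤ → Bool) :=
  {ω | ∀ (i : ℤ) (m : ℕ), 1 ≤ m →
    ∃ n k, 1 ≤ n ∧ k ≤ n ∧
      (List.ofFn fun t : Fin m => ω (i + (t : ℕ))) <:+: Bblk n k}

/-- The left shift on bi-infinite sequences. -/
def shift : (ℤ → Bool) → (ℤ → Bool) := fun ω i => ω (i + 1)

lemma shift_mem_Sig {ω : ℤ → Bool} (h : ω ∈ Sig) : shift ω ∈ Sig := by
  intro i m hm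
  obtain ⟨n, k, h1, h2, h3⟩ := h (i + 1) m hm
  refine ⟨n, k, h1, h2, ?_⟩
  have e : (List.ofFn fun t : Fin m => shift ω (i + (t : ℕ))) =
      List.ofFn fun t : Fin m => ω (i + 1 + (t : ℕ)) := by
    congr 1
    funext t
    show ω (i + (t : ℕ) + 1) = ω (i + 1 + (t : ℕ))
    exact congrArg ω (by ring)
  rw [e]
  exact h3

/-- The shift `σ` on the Pascal subshift. -/
def sigmaS : ↥Sig → ↥Sig := fun ω => ⟨shift ω.1, shift_mem_Sig ω.2⟩

open Filter Topology Finset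

/-- The Cesàro average of the first `N` terms of a complex sequence. -/
noncomputable def cesaroAvg (x : ℕ → ℂ) (N : ℕ) : ℂ := (N : ℂ)⁻¹ * ∑ u ∈ range N, x u

lemma cesaroAvg_shift_sub {x : ℕ → ℂ} (hx : ∀ u, ‖x u‖ ≤ 1) (h N : ℕ) :
    ‖cesaroAvg (fun u => x (u + h)) N - cesaroAvg x N‖ ≤ (N : ℝ)⁻¹ * (2 * h) := by
  have key : ‖∑ u ∈ range N, x (u + h) - ∑ u ∈ range N, x u‖ ≤ 2 * h := by
    induction h with
    | zero => simp
    | succ h ih =>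
      have e : ∑ u ∈ range N, x (u + (h + 1)) - ∑ u ∈ range N, x u
          = (∑ u ∈ range N, x (u + h) - ∑ u ∈ range N, x u) + (x (N + h) - x h) := by
        have h1 := Finset.sum_range_succ (fun u => x (u + h)) N
        have h2 := Finset.sum_range_succ' (fun u => x (u + h)) N
        rw [h1] at h2
        have h3 : ∑ u ∈ range N, x (u + (h + 1)) = ∑ u ∈ range N, x (u + 1 + h) :=
          Finset.sum_congr rfl fun u _ => by congr 1; ring
        simp only [zero_add] at h2
        rw [h3]
        linear_combination -h2
      rw [e]
      refine (norm_add_le _ _).trans ?_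
      have := (norm_sub_le (x (N + h)) (x h)).trans (add_le_add (hx _) (hx _))
      push_cast
      linarith
  unfold cesaroAvg
  rw [← mul_sub, norm_mul, norm_inv, Complex.norm_natCast]
  gcongr

lemma tendsto_cesaroAvg_shift {x : ℕ → ℂ} (hx : ∀ u, ‖x u‖ ≤ 1) (h : ℕ) {c : ℂ}
    (ht : Tendsto (cesaroAvg x) atTop (𝓝 c)) :
    Tendsto (cesaroAvg fun u => x (u + h)) atTop (𝓝 c) := by
  have h0 : Tendsto (fun N => cesaroAvg (fun u => x (u + h)) N - cesaroAvg x N) atTop (𝓝 0) := by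
    refine squeeze_zero_norm (fun N => cesaroAvg_shift_sub hx h N) ?_
    have := (tendsto_inv_atTop_nhds_zero_nat (𝕜 := ℝ)).mul_const (2 * (h : ℝ))
    simpa using this
  simpa using h0.add ht

lemma norm_cesaroAvg_sq_le (y : ℕ → ℂ) (N : ℕ) :
    ‖cesaroAvg y N‖ ^ 2 ≤ (cesaroAvg (fun u => y u * starRingEnd ℂ (y u)) N).re := by
  rcases Nat.eq_zero_or_pos N with rfl | hN
  · simp [cesaroAvg]
  have h1 : (cesaroAvg (fun u => y u * starRingEnd ℂ (y u)) N).re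
      = (N : ℝ)⁻¹ * ∑ u ∈ range N, ‖y u‖ ^ 2 := by
    have : cesaroAvg (fun u => y u * starRingEnd ℂ (y u)) N
        = (((N : ℝ)⁻¹ * ∑ u ∈ range N, ‖y u‖ ^ 2 : ℝ) : ℂ) := by
      simp [cesaroAvg, Complex.mul_conj, Complex.normSq_eq_norm_sq]
    rw [this, Complex.ofReal_re]
  rw [h1]
  unfold cesaroAvg
  rw [norm_mul, norm_inv, Complex.norm_natCast]
  have h2 : ‖∑ u ∈ range N, y u‖ ≤ ∑ u ∈ range N, ‖y u‖ := norm_sum_le _ _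
  have h3 := sq_sum_le_card_mul_sum_sq (s := range N) (f := fun u => ‖y u‖)
  rw [card_range] at h3
  have hN' : (0 : ℝ) < N := by exact_mod_cast hN
  have h4 : ‖∑ u ∈ range N, y u‖ ^ 2 ≤ N * ∑ u ∈ range N, ‖y u‖ ^ 2 :=
    (pow_le_pow_left₀ (norm_nonneg _) h2 2).trans h3
  rw [mul_pow]
  calc (N : ℝ)⁻¹ ^ 2 * ‖∑ u ∈ range N, y u‖ ^ 2
      ≤ (N : ℝ)⁻¹ ^ 2 * (N * ∑ u ∈ range N, ‖y u‖ ^ 2) := by gcongr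
    _ = _ := by field_simp

/-- Van der Corput's difference theorem. -/
theorem tendsto_cesaroAvg_of_correlations {x : ℕ → ℂ} (hx : ∀ u, ‖x u‖ = 1)
    (hc : ∀ h, 1 ≤ h →
      Tendsto (cesaroAvg fun u => x (u + h) * starRingEnd ℂ (x u)) atTop (𝓝 0)) :
    Tendsto (cesaroAvg x) atTop (𝓝 0) := by
  have hx' : ∀ u, ‖x u‖ ≤ 1 := fun u => (hx u).le
  have corr : ∀ h h' : ℕ, Tendsto (cesaroAvg fun u => x (u + h) * starRingEnd ℂ (x (u + h')))
      atTop (𝓝 (if h = h' then 1 else 0)) := by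
    have aux : ∀ h h' : ℕ, h' < h →
        Tendsto (cesaroAvg fun u => x (u + h) * starRingEnd ℂ (x (u + h'))) atTop (𝓝 0) := by
      intro h h' hh
      have h1 := tendsto_cesaroAvg_shift (x := fun u => x (u + (h - h')) * starRingEnd ℂ (x u))
        (fun u => by simp [hx]) h' (hc (h - h') (by omega))
      refine h1.congr fun N => ?_
      congr 1
      funext u
      rw [show u + h' + (h - h') = u + h by omega]
    intro h h'
    rcases lt_trichotomy h h' with hlt | rfl | hlt
    · rw [if_neg hlt.ne]
      have h1 := (Complex.continuous_conj.tendsto _).comp (aux h' h hlt)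
      simp only [map_zero] at h1
      refine h1.congr fun N => ?_
      simp [cesaroAvg, mul_comm]
    · rw [if_pos rfl]
      refine tendsto_const_nhds.congr' ?_
      filter_upwards [eventually_gt_atTop 0] with N hN
      have : (N : ℂ) ≠ 0 := by exact_mod_cast hN.ne'
      simp [cesaroAvg, Complex.mul_conj, Complex.normSq_eq_norm_sq, hx, this]
    · rw [if_neg hlt.ne']
      exact aux h h' hlt
  have main : ∀ H : ℕ, 1 ≤ H → ∀ᶠ N in atTop, ‖cesaroAvg x N‖ * H ≤ √(H + 1) + 1 := by
    intro H hH
    set Y : ℕ → ℂ := fun u => ∑ h ∈ range H, x (u + h) with hY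
    have t1 : Tendsto (fun N => (cesaroAvg (fun u => Y u * starRingEnd ℂ (Y u)) N).re)
        atTop (𝓝 H) := by
      have h1 : Tendsto (fun N => ∑ h ∈ range H, ∑ h' ∈ range H,
          cesaroAvg (fun u => x (u + h) * starRingEnd ℂ (x (u + h'))) N) atTop
          (𝓝 (∑ h ∈ range H, ∑ h' ∈ range H, if h = h' then 1 else 0)) :=
        tendsto_finsetSum _ fun h _ => tendsto_finsetSum _ fun h' _ => corr h h'
      have h2 : (∑ h ∈ range H, ∑ h' ∈ range H, if h = h' then (1 : ℂ) else 0) = H := by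
        rw [Finset.sum_congr rfl (g := fun _ => (1 : ℂ))]
        · simp
        · intro h hh
          rw [Finset.sum_ite_eq, if_pos hh]
      rw [h2] at h1
      have h3 := (Complex.continuous_re.tendsto _).comp h1
      simp only [Complex.natCast_re] at h3
      refine h3.congr fun N => ?_
      simp only [Function.comp]
      congr 1
      simp only [cesaroAvg, hY, map_sum, Finset.sum_mul_sum, ← Finset.mul_sum]
      congr 1
      rw [Finset.sum_comm]
      conv_rhs => rw [Finset.sum_comm]
      conv_lhs => rw [Finset.sum_comm]
      refine Finset.sum_congr rfl fun h _ => ?_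
      rw [Finset.sum_comm]
      exact Finset.sum_congr rfl fun u _ => (Finset.mul_sum _ _ _).symm
    have t2 : ∀ N, ‖cesaroAvg x N‖ * H ≤ ‖cesaroAvg Y N‖ + (N : ℝ)⁻¹ * (2 * H * H) := by
      intro N
      have e : cesaroAvg Y N = ∑ h ∈ range H, cesaroAvg (fun u => x (u + h)) N := by
        simp only [cesaroAvg, hY, ← Finset.mul_sum]
        rw [Finset.sum_comm]
      have e2 : cesaroAvg x N * H = cesaroAvg Y N
          - ∑ h ∈ range H, (cesaroAvg (fun u => x (u + h)) N - cesaroAvg x N) := by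
        rw [e, Finset.sum_sub_distrib]
        simp [mul_comm]
      have e3 : ‖cesaroAvg x N‖ * H = ‖cesaroAvg x N * H‖ := by simp
      rw [e3, e2]
      refine (norm_sub_le _ _).trans (add_le_add le_rfl ?_)
      refine (norm_sum_le_of_le _ (fun h hh => (cesaroAvg_shift_sub hx' h N).trans
        (b := _) (c := (N : ℝ)⁻¹ * (2 * H)) ?_)).trans ?_
      · have : (h : ℝ) ≤ H := by exact_mod_cast (Finset.mem_range.1 hh).le
        gcongr
      · simp; apply le_of_eq; ring
    have t3 : Tendsto (fun N : ℕ => (N : ℝ)⁻¹ * (2 * H * H)) atTop (𝓝 0) := by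
      simpa using (tendsto_inv_atTop_nhds_zero_nat (𝕜 := ℝ)).mul_const (2 * (H : ℝ) * H)
    filter_upwards [t1.eventually (gt_mem_nhds (show (H : ℝ) < H + 1 by linarith)),
      t3.eventually (gt_mem_nhds one_pos)] with N h1 h3
    have h4 : ‖cesaroAvg Y N‖ ≤ √(H + 1) :=
      Real.le_sqrt_of_sq_le ((norm_cesaroAvg_sq_le Y N).trans h1.le)
    linarith [t2 N]
  rw [tendsto_zero_iff_norm_tendsto_zero, tendsto_order]
  refine ⟨fun a ha => Eventually.of_forall fun N => ha.trans_le (norm_nonneg _), fun ε hε => ?_⟩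
  obtain ⟨H, hH⟩ := exists_nat_gt (max 1 (9 / ε ^ 2))
  have hH1 : (1 : ℝ) < H := (le_max_left _ _).trans_lt hH
  have hH2 : 9 / ε ^ 2 < H := (le_max_right _ _).trans_lt hH
  filter_upwards [main H (by exact_mod_cast hH1.le)] with N hN
  have hs : √(H + 1) + 1 ≤ 3 * √H := by
    have h1 : √((H : ℝ) + 1) ≤ 2 * √H := by
      rw [Real.sqrt_le_left (by positivity), mul_pow, Real.sq_sqrt (by linarith)]
      linarith
    have h2 : 1 ≤ √(H : ℝ) := Real.one_le_sqrt.2 hH1.le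
    linarith
  have hsq : √(H : ℝ) * √H = H := Real.mul_self_sqrt (by linarith)
  have hpos : 0 < √(H : ℝ) := Real.sqrt_pos.2 (by linarith)
  have h5 : 3 < ε * √H := by
    rw [div_lt_iff₀ (by positivity)] at hH2
    have : (3 : ℝ) ^ 2 < (ε * √H) ^ 2 := by
      rw [mul_pow, Real.sq_sqrt (by linarith)]; linarith
    exact lt_of_pow_lt_pow_left₀ 2 (by positivity) this
  have h6 : ‖cesaroAvg x N‖ * √H ≤ 3 := by
    have : ‖cesaroAvg x N‖ * √H * √H ≤ 3 * √H := by rw [mul_assoc, hsq]; linarith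
    exact le_of_mul_le_mul_right this hpos
  exact lt_of_mul_lt_mul_right (h6.trans_lt h5) hpos.le

/-- Integer sequences behaving like polynomials of exact degree `n` under taking differences. -/
def PolyLike : ℕ → (ℕ → ℤ) → Prop
  | 0, p => ∃ c : ℤ, c ≠ 0 ∧ ∀ u, p u = c
  | n + 1, p => ∀ h, 1 ≤ h → PolyLike n fun u => p (u + h) - p u

lemma PolyLike.comp_affine {n : ℕ} {p : ℕ → ℤ} (hp : PolyLike n p) (s : ℕ) {c : ℕ} (hc : 1 ≤ c) :
    PolyLike n fun u => p (s + c * u) := by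
  induction n generalizing p with
  | zero =>
    obtain ⟨a, ha, h⟩ := hp
    exact ⟨a, ha, fun u => h _⟩
  | succ n ih =>
    intro h hh
    have := ih (hp (c * h) (Nat.mul_pos hc hh))
    simpa only [mul_add, add_assoc] using this

lemma PolyLike.add_const {n : ℕ} {p : ℕ → ℤ} (hp : PolyLike (n + 1) p) (a : ℤ) :
    PolyLike (n + 1) fun u => p u + a := by
  intro h hh
  simpa using hp h hh

lemma polyLike_sum_choose (l : ℕ) {ι : Type} (s : Finset ι) (hs : s.Nonempty) (f : ι → ℕ) :
    PolyLike l fun u => ∑ i ∈ s, ((u + f i).choose l : ℤ) := by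
  induction l generalizing ι with
  | zero =>
    refine ⟨s.card, by exact_mod_cast hs.card_pos.ne', fun u => by simp⟩
  | succ l ih =>
    intro h hh
    have := ih (s ×ˢ range h) (hs.product (by simpa using (by omega : h ≠ 0)))
      (fun x => f x.1 + x.2)
    convert this using 2 with u
    rw [Finset.sum_product, ← Finset.sum_sub_distrib]
    refine Finset.sum_congr rfl fun i _ => ?_
    clear this hh
    induction h with
    | zero => simp
    | succ h ih' =>
      rw [Finset.sum_range_succ, ← ih',
        show u + (h + 1) + f i = (u + (f i + h)) + 1 by ring, Nat.choose_succ_succ,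
        show u + h + f i = u + (f i + h) by ring]
      push_cast
      ring

lemma polyLike_choose (l : ℕ) : PolyLike l fun u => (u.choose l : ℤ) := by
  simpa using polyLike_sum_choose l {()} (by simp) fun _ => 0

lemma tendsto_cesaroAvg_pow {z : ℂ} (hz : ‖z‖ = 1) (hz' : z ≠ 1) :
    Tendsto (cesaroAvg fun u => z ^ u) atTop (𝓝 0) := by
  have hb : ∀ N, ‖cesaroAvg (fun u => z ^ u) N‖ ≤ (N : ℝ)⁻¹ * (2 / ‖z - 1‖) := by
    intro N
    simp only [cesaroAvg]
    rw [geom_sum_eq hz', norm_mul, norm_inv, Complex.norm_natCast, norm_div]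
    gcongr
    refine (norm_sub_le _ _).trans ?_
    rw [norm_pow, hz]
    norm_num
  refine squeeze_zero_norm hb ?_
  simpa using (tendsto_inv_atTop_nhds_zero_nat (𝕜 := ℝ)).mul_const (2 / ‖z - 1‖)

lemma norm_cesaroAvg_le {x : ℕ → ℂ} (hx : ∀ u, ‖x u‖ ≤ 1) (N : ℕ) : ‖cesaroAvg x N‖ ≤ 1 := by
  rcases Nat.eq_zero_or_pos N with rfl | hN
  · simp [cesaroAvg]
  have hN' : (0 : ℝ) < N := by exact_mod_cast hN
  rw [cesaroAvg, norm_mul, norm_inv, Complex.norm_natCast, inv_mul_le_one₀ hN']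
  simpa using norm_sum_le_of_le (range N) fun u _ => hx u

/-- Weyl's theorem for powers of a unimodular number that is not a root of unity. -/
theorem tendsto_cesaroAvg_zpow {z : ℂ} (hz : ‖z‖ = 1) (hz' : ∀ c : ℤ, c ≠ 0 → z ^ c ≠ 1)
    {n : ℕ} {p : ℕ → ℤ} (hp : PolyLike (n + 1) p) :
    Tendsto (cesaroAvg fun u => z ^ p u) atTop (𝓝 0) := by
  have hz0 : z ≠ 0 := by rintro rfl; simp at hz
  induction n generalizing p with
  | zero =>
    obtain ⟨c, hc, h⟩ := hp 1 le_rfl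
    have e : ∀ u, z ^ p u = z ^ p 0 * (z ^ c) ^ u := by
      intro u
      induction u with
      | zero => simp
      | succ u ih =>
        rw [pow_succ, ← mul_assoc, ← ih, ← zpow_add₀ hz0, ← h u]
        congr 1
        ring
    have h1 := (tendsto_cesaroAvg_pow (z := z ^ c) (by rw [norm_zpow, hz, one_zpow])
      (hz' c hc)).const_mul (z ^ p 0)
    rw [mul_zero] at h1
    refine h1.congr fun N => ?_
    rw [funext e]
    simp only [cesaroAvg, ← Finset.mul_sum]
    ring
  | succ n ih =>
    refine tendsto_cesaroAvg_of_correlations (fun u => by rw [norm_zpow, hz, one_zpow]) ?_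
    intro h hh
    refine (ih (hp h hh)).congr fun N => ?_
    congr 1
    funext u
    have : starRingEnd ℂ (z ^ p u) = z ^ (-p u) := by
      rw [map_zpow₀, ← Complex.inv_eq_conj hz, zpow_neg, inv_zpow]
    rw [this, ← zpow_add₀ hz0, sub_eq_add_neg]

open MeasureTheory AddCircle
open scoped Pointwise

/-- The character `θ ↦ exp (2πinθ)` of `ℝ/ℤ`. -/
noncomputable def echar (n : ℤ) (θ : AddCircle (1 : ℝ)) : ℂ := fourier n θ

lemma continuous_echar (n : ℤ) : Continuous (echar n) := (fourier n).continuous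

lemma echar_add (m n : ℤ) (θ : AddCircle (1 : ℝ)) : echar (m + n) θ = echar m θ * echar n θ :=
  fourier_add

lemma echar_neg (n : ℤ) (θ : AddCircle (1 : ℝ)) : echar (-n) θ = starRingEnd ℂ (echar n θ) :=
  fourier_neg

lemma echar_zero (θ : AddCircle (1 : ℝ)) : echar 0 θ = 1 := fourier_zero

lemma norm_echar (n : ℤ) (θ : AddCircle (1 : ℝ)) : ‖echar n θ‖ = 1 := Circle.norm_coe _

lemma echar_eq_one_iff {n : ℤ} {θ : AddCircle (1 : ℝ)} : echar n θ = 1 ↔ n • θ = 0 := by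
  have h : echar n θ = (toCircle (n • θ) : ℂ) := rfl
  rw [h, ← fourier_zero' (T := 1), Circle.coe_inj]
  exact (AddCircle.injective_toCircle one_ne_zero).eq_iff

lemma echar_eq_zpow (n : ℤ) (θ : AddCircle (1 : ℝ)) : echar n θ = echar 1 θ ^ n := by
  have h : ∀ m : ℤ, echar m θ = (toCircle (m • θ) : ℂ) := fun m => rfl
  rw [h, h, toCircle_zsmul, one_smul, Circle.coe_zpow]

lemma integrable_of_continuous_addCircle (μ : Measure (AddCircle (1 : ℝ))) [IsFiniteMeasure μ]
    {E : Type*} [NormedAddCommGroup E] {f : AddCircle (1 : ℝ) → E} [SecondCountableTopology E]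
    (hf : Continuous f) : Integrable f μ := by
  borelize E
  obtain ⟨C, hC⟩ := isCompact_univ.exists_bound_of_continuousOn hf.continuousOn
  exact Integrable.of_bound hf.aestronglyMeasurable C (Eventually.of_forall fun x => hC x trivial)

lemma integral_echar (n : ℤ) : ∫ θ, echar n θ ∂haarAddCircle = if n = 0 then 1 else 0 := by
  split_ifs with h
  · subst h
    simp [echar_zero]
  · have := fourier_add_half_inv_index h (T := 1) one_pos
    exact integral_eq_zero_of_add_right_eq_neg (μ := haarAddCircle) this

/-- The trigonometric polynomial with frequency set `S`. -/
noncomputable def trigSum (S : Finset ℤ) (θ : AddCircle (1 : ℝ)) : ℂ := ∑ x ∈ S, echar x θ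

lemma continuous_trigSum (S : Finset ℤ) : Continuous (trigSum S) :=
  continuous_finsetSum _ fun x _ => continuous_echar x

lemma trigSum_sq (S : Finset ℤ) (θ : AddCircle (1 : ℝ)) :
    ((‖trigSum S θ‖ ^ 2 : ℝ) : ℂ) = ∑ z ∈ S ×ˢ S, echar (z.1 - z.2) θ := by
  have : ((‖trigSum S θ‖ ^ 2 : ℝ) : ℂ) = trigSum S θ * starRingEnd ℂ (trigSum S θ) := by
    rw [Complex.mul_conj, Complex.normSq_eq_norm_sq]
  rw [this]
  simp only [trigSum, map_sum, Finset.sum_mul_sum, Finset.sum_product, ← echar_neg, ← echar_add,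
    sub_eq_add_neg]

lemma integral_trigSum_sq_mul_echar (S : Finset ℤ) (n : ℤ) :
    ∫ θ, ((‖trigSum S θ‖ ^ 2 : ℝ) : ℂ) * echar n θ ∂haarAddCircle
      = ((S ×ˢ S).filter fun z => z.1 - z.2 + n = 0).card := by
  simp only [trigSum_sq, Finset.sum_mul, ← echar_add]
  rw [integral_finsetSum _ fun z _ => integrable_of_continuous_addCircle _ (continuous_echar _)]
  simp [integral_echar]

lemma integral_trigSum_sq_mul_trigSum_sq (S T : Finset ℤ) :
    ∫ θ, ‖trigSum S θ‖ ^ 2 * ‖trigSum T θ‖ ^ 2 ∂haarAddCircle = Finset.addEnergy S T := by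
  have h : ∫ θ, ((‖trigSum S θ‖ ^ 2 * ‖trigSum T θ‖ ^ 2 : ℝ) : ℂ) ∂haarAddCircle
      = (Finset.addEnergy S T : ℂ) := by
    simp only [Complex.ofReal_mul, trigSum_sq, Finset.sum_mul_sum, ← echar_add]
    rw [integral_finsetSum _ fun z _ => integrable_of_continuous_addCircle _
      (continuous_finsetSum _ fun _ _ => continuous_echar _)]
    simp_rw [integral_finsetSum _ fun z _ => integrable_of_continuous_addCircle _
      (continuous_echar _), integral_echar]
    rw [← Finset.sum_product', Finset.addEnergy, ← Finset.sum_filter]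
    simp only [Finset.sum_const, nsmul_eq_mul, mul_one]
    congr 2
    ext z
    simp only [Finset.mem_filter]
    refine and_congr_right fun _ => ?_
    omega
  rw [integral_complex_ofReal] at h
  exact_mod_cast h

/-- The measure with density `‖∑_{x ∈ S} e(xθ)‖² / |S|`. -/
noncomputable def spectralMeasure (S : Finset ℤ) : Measure (AddCircle (1 : ℝ)) :=
  haarAddCircle.withDensity fun θ => ((‖trigSum S θ‖₊ ^ 2 / S.card : NNReal) : ENNReal)

lemma integral_spectralMeasure {E : Type*} [NormedAddCommGroup E] [NormedSpace ℝ E]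
    (S : Finset ℤ) (g : AddCircle (1 : ℝ) → E) :
    ∫ θ, g θ ∂spectralMeasure S = ∫ θ, (‖trigSum S θ‖ ^ 2 / S.card) • g θ ∂haarAddCircle := by
  unfold spectralMeasure
  rw [integral_withDensity_eq_integral_smul]
  · simp [NNReal.smul_def]
  · exact ((continuous_trigSum S).nnnorm.pow 2 |>.div_const _).measurable

lemma isProbabilityMeasure_spectralMeasure {S : Finset ℤ} (hS : S.Nonempty) :
    IsProbabilityMeasure (spectralMeasure S) := by
  have hc : (S.card : ℝ) ≠ 0 := by exact_mod_cast hS.card_pos.ne'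
  have h1 : ∫ θ, ‖trigSum S θ‖ ^ 2 ∂haarAddCircle = (S.card : ℝ) := by
    have h := integral_trigSum_sq_mul_echar S 0
    simp only [echar_zero, mul_one, add_zero, sub_eq_zero] at h
    rw [integral_complex_ofReal] at h
    have h2 : ((S ×ˢ S).filter fun z => z.1 = z.2).card = S.card := by
      rw [← Finset.diag_eq_filter, Finset.diag_card]
    rw [h2] at h
    exact_mod_cast h
  constructor
  unfold spectralMeasure
  rw [withDensity_apply _ MeasurableSet.univ, Measure.restrict_univ]
  have h3 := ofReal_integral_eq_lintegral_ofReal (μ := haarAddCircle)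
    (f := fun θ => ‖trigSum S θ‖ ^ 2 / S.card)
    (integrable_of_continuous_addCircle _ (((continuous_trigSum S).norm.pow 2).div_const _))
    (Eventually.of_forall fun θ => by positivity)
  rw [integral_div, h1, div_self hc, ENNReal.ofReal_one] at h3
  rw [h3]
  refine lintegral_congr fun θ => ?_
  rw [← ENNReal.ofReal_coe_nnreal]
  simp

lemma integral_echar_spectralMeasure (S : Finset ℤ) (n : ℤ)
    (h : ∫ θ, echar n θ ∂spectralMeasure S ≠ 0) : ∃ x ∈ S, ∃ y ∈ S, y - x = n := by
  by_contra! hcon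
  apply h
  rw [integral_spectralMeasure]
  have e : ∀ θ, (‖trigSum S θ‖ ^ 2 / S.card) • echar n θ
      = (((‖trigSum S θ‖ ^ 2 : ℝ) : ℂ) * echar n θ) * (S.card : ℂ)⁻¹ := by
    intro θ
    rw [Complex.real_smul]
    push_cast
    ring
  simp_rw [e]
  rw [integral_mul_const, integral_trigSum_sq_mul_echar, Finset.filter_eq_empty_iff.2]
  · simp
  · rintro ⟨x, y⟩ hz h0
    rw [Finset.mem_product] at hz
    exact hcon x hz.1 y hz.2 (by dsimp at h0; omega)

lemma cesaroAvg_echar (N : ℕ) (θ : AddCircle (1 : ℝ)) :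
    cesaroAvg (fun u => echar u θ) N = (N : ℂ)⁻¹ * trigSum (Finset.Ico 0 (N : ℤ)) θ := by
  unfold cesaroAvg trigSum
  congr 1
  refine Finset.sum_nbij (fun u => (u : ℤ)) ?_ ?_ ?_ fun _ _ => rfl
  · intro u hu; simpa using hu
  · intro u _ v _ h; exact Nat.cast_injective h
  · intro x hx
    simp only [coe_Ico, Set.mem_Ico] at hx
    exact ⟨x.toNat, by simp; omega, by simp [hx.1]⟩

lemma le_integral_cesaroAvg_spectralMeasure {S : Finset ℤ} (hS : S.Nonempty) {L : ℕ}
    (hL : S ⊆ Finset.Ico 0 (L : ℤ)) {N : ℕ} (hN : 1 ≤ N) :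
    (S.card : ℝ) / (L + N) ≤
      ∫ θ, ‖cesaroAvg (fun u => echar u θ) N‖ ^ 2 ∂spectralMeasure S := by
  have hc : (0 : ℝ) < S.card := by exact_mod_cast hS.card_pos
  have hN' : (0 : ℝ) < N := by exact_mod_cast hN
  set T := Finset.Ico 0 (N : ℤ) with hT
  have hTc : T.card = N := by simp [hT]
  have h1 : ∫ θ, ‖cesaroAvg (fun u => echar u θ) N‖ ^ 2 ∂spectralMeasure S
      = (Finset.addEnergy S T : ℝ) / (S.card * N ^ 2) := by
    rw [integral_spectralMeasure, ← integral_trigSum_sq_mul_trigSum_sq, ← integral_div]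
    refine integral_congr_ae (Eventually.of_forall fun θ => ?_)
    simp only [cesaroAvg_echar, norm_mul, norm_inv, Complex.norm_natCast, smul_eq_mul]
    rw [← hT]
    field_simp
  have h2 := le_card_add_mul_addEnergy S T
  have h3 : (S + T).card ≤ L + N := by
    have : S + T ⊆ Finset.Ico 0 ((L + N : ℕ) : ℤ) := by
      intro z hz
      obtain ⟨x, hx, y, hy, rfl⟩ := Finset.mem_add.1 hz
      have h4 := Finset.mem_Ico.1 (hL hx)
      have h5 := Finset.mem_Ico.1 hy
      rw [Finset.mem_Ico]
      push_cast
      omega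
    have h6 := Finset.card_le_card this
    rwa [Int.card_Ico, sub_zero, Int.toNat_natCast] at h6
  have h4 : (S.card : ℝ) ^ 2 * N ^ 2 ≤ (L + N) * Finset.addEnergy S T := by
    have : S.card ^ 2 * N ^ 2 ≤ (L + N) * Finset.addEnergy S T := by
      rw [hTc] at h2
      exact h2.trans (Nat.mul_le_mul_right _ h3)
    exact_mod_cast this
  rw [h1, div_le_div_iff₀ (by positivity) (by positivity)]
  linarith

lemma continuous_cesaroAvg {X : Type*} [TopologicalSpace X] {f : ℕ → X → ℂ}
    (hf : ∀ u, Continuous (f u)) (N : ℕ) : Continuous fun θ => cesaroAvg (fun u => f u θ) N :=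
  continuous_const.mul (continuous_finsetSum _ fun u _ => hf u)

lemma tendsto_integral_cesaroAvg_echar (μ : Measure (AddCircle (1 : ℝ))) [IsFiniteMeasure μ] :
    Tendsto (fun N => ∫ θ, ‖cesaroAvg (fun u => echar u θ) N‖ ^ 2 ∂μ) atTop (𝓝 (μ.real {0})) := by
  have h1 : μ.real {0} = ∫ θ, Set.indicator {0} (fun _ => (1 : ℝ)) θ ∂μ := by
    rw [integral_indicator_const _ (measurableSet_singleton _)]
    simp
  rw [h1]
  refine tendsto_integral_of_dominated_convergence (fun _ => 1) ?_ (integrable_const _) ?_ ?_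
  · exact fun N => ((continuous_cesaroAvg
      (fun u => continuous_echar u) N).norm.pow 2).aestronglyMeasurable
  · refine fun N => Eventually.of_forall fun θ => ?_
    rw [Real.norm_of_nonneg (by positivity)]
    exact pow_le_one₀ (norm_nonneg _) (norm_cesaroAvg_le (fun u => (norm_echar _ _).le) N)
  · refine Eventually.of_forall fun θ => ?_
    by_cases hθ : θ = 0
    · subst hθ
      rw [Set.indicator_of_mem (Set.mem_singleton _)]
      refine tendsto_const_nhds.congr' ?_
      filter_upwards [eventually_gt_atTop 0] with N hN
      have : (N : ℂ) ≠ 0 := by exact_mod_cast hN.ne'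
      have h0 : ∀ n, echar n 0 = 1 := fun n => echar_eq_one_iff.2 (smul_zero _)
      simp [cesaroAvg, h0, this]
    · rw [Set.indicator_of_notMem (by simpa using hθ)]
      have h2 := tendsto_cesaroAvg_pow (norm_echar 1 θ)
        (fun h => hθ (by simpa using echar_eq_one_iff.1 h))
      have h3 := (h2.norm).pow 2
      simp only [norm_zero, ne_eq, OfNat.ofNat_ne_zero, not_false_eq_true, zero_pow] at h3
      refine h3.congr fun N => ?_
      congr 3
      funext u
      rw [echar_eq_zpow (u : ℤ), zpow_natCast]

/-- The elements of finite order of `ℝ/ℤ` that are not killed by `W`. -/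
def badTorsion (W : ℕ) : Set (AddCircle (1 : ℝ)) :=
  {θ | (∃ n : ℕ, n ≠ 0 ∧ n • θ = 0) ∧ W • θ ≠ 0}

lemma isClosed_nsmul_eq_zero (n : ℕ) : IsClosed {θ : AddCircle (1 : ℝ) | n • θ = 0} :=
  isClosed_eq (continuous_nsmul n) continuous_const

lemma measurableSet_badTorsion (W : ℕ) : MeasurableSet (badTorsion W) := by
  have : badTorsion W = (⋃ n : ℕ, ⋃ _ : n ≠ 0, {θ : AddCircle (1 : ℝ) | n • θ = 0})
      \ {θ | W • θ = 0} := by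
    ext θ
    simp [badTorsion]
  rw [this]
  exact (MeasurableSet.iUnion fun n => MeasurableSet.iUnion fun _ =>
    (isClosed_nsmul_eq_zero n).measurableSet).diff (isClosed_nsmul_eq_zero W).measurableSet

lemma exists_measureReal_badTorsion_lt (μ : Measure (AddCircle (1 : ℝ))) [IsFiniteMeasure μ]
    {δ : ℝ} (hδ : 0 < δ) : ∃ W, 1 ≤ W ∧ μ.real (badTorsion W) < δ := by
  have kill : ∀ (i : ℕ) (n : ℕ) (θ : AddCircle (1 : ℝ)), n ∣ i → n • θ = 0 → i • θ = 0 := by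
    rintro i n θ ⟨k, rfl⟩ h
    rw [mul_comm, mul_nsmul', h, smul_zero]
  have h := tendsto_measure_iInter_atTop (μ := μ) (s := fun j : ℕ => badTorsion j.factorial)
    (fun j => (measurableSet_badTorsion _).nullMeasurableSet)
    (fun i j hij θ hθ => ⟨hθ.1, fun h => hθ.2 (kill _ _ _ (Nat.factorial_dvd_factorial hij) h)⟩)
    ⟨0, measure_ne_top _ _⟩
  have h0 : ⋂ j : ℕ, badTorsion j.factorial = ∅ := by
    refine Set.eq_empty_of_forall_notMem fun θ hθ => ?_
    rw [Set.mem_iInter] at hθ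
    obtain ⟨n, hn, hnθ⟩ := (hθ 0).1
    exact (hθ n).2 (kill _ _ _ (Nat.dvd_factorial (Nat.pos_of_ne_zero hn) le_rfl) hnθ)
  rw [h0, measure_empty] at h
  have h' := (ENNReal.tendsto_toReal ENNReal.zero_ne_top).comp h
  obtain ⟨j, hj⟩ := (h'.eventually (gt_mem_nhds hδ)).exists
  exact ⟨j.factorial, Nat.factorial_pos j, hj⟩

/-- A measure on the circle with an atom at zero correlates with every sequence of polynomial type
all of whose terms are divisible by a suitable modulus. -/
theorem exists_integral_echar_ne_zero (μ : Measure (AddCircle (1 : ℝ))) [IsFiniteMeasure μ]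
    (h0 : 0 < μ.real {0}) : ∃ W : ℕ, 1 ≤ W ∧ ∀ (n : ℕ) (p : ℕ → ℤ), PolyLike (n + 1) p →
      (∀ u, (W : ℤ) ∣ p u) → ∃ u, ∫ θ, echar (p u) θ ∂μ ≠ 0 := by
  obtain ⟨W, hW, hlt⟩ := exists_measureReal_badTorsion_lt μ h0
  refine ⟨W, hW, fun n p hp hdvd => ?_⟩
  by_contra! hcon
  set K : Set (AddCircle (1 : ℝ)) := {θ | W • θ = 0} with hK
  set Bd := badTorsion W with hBd
  have hKm : MeasurableSet K := (isClosed_nsmul_eq_zero W).measurableSet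
  have hBm : MeasurableSet Bd := measurableSet_badTorsion W
  set F : ℕ → AddCircle (1 : ℝ) → ℂ := fun N θ => cesaroAvg (fun u => echar (p u) θ) N with hF
  have hFc : ∀ N, Continuous (F N) := fun N => continuous_cesaroAvg (fun u => continuous_echar _) N
  have hFi : ∀ N, Integrable (F N) μ := fun N => integrable_of_continuous_addCircle _ (hFc N)
  have hFb : ∀ N θ, ‖F N θ‖ ≤ 1 := fun N θ => norm_cesaroAvg_le (fun u => (norm_echar _ _).le) N
  have hF0 : ∀ N, ∫ θ, F N θ ∂μ = 0 := by
    intro N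
    simp only [hF, cesaroAvg]
    rw [integral_const_mul, integral_finsetSum _ fun u _ =>
      integrable_of_continuous_addCircle _ (continuous_echar _)]
    simp [hcon]
  have hbound : ∀ N, ‖∫ θ in Bdᶜ, F N θ ∂μ‖ ≤ μ.real Bd := by
    intro N
    have h1 := integral_add_compl hBm (hFi N)
    rw [hF0] at h1
    rw [← norm_neg, ← eq_neg_of_add_eq_zero_left h1]
    simpa using norm_setIntegral_le_of_norm_le_const (measure_lt_top μ Bd)
      (fun θ _ => hFb N θ)
  have hlim : Tendsto (fun N => ∫ θ in Bdᶜ, F N θ ∂μ) atTop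
      (𝓝 (∫ θ in Bdᶜ, K.indicator (fun _ => (1 : ℂ)) θ ∂μ)) := by
    refine tendsto_integral_of_dominated_convergence (fun _ => 1)
      (fun N => (hFc N).aestronglyMeasurable) (integrable_const _)
      (fun N => Eventually.of_forall fun θ => hFb N θ) ?_
    rw [ae_restrict_iff' hBm.compl]
    refine Eventually.of_forall fun θ hθ => ?_
    by_cases hθK : θ ∈ K
    · rw [Set.indicator_of_mem hθK]
      refine tendsto_const_nhds.congr' ?_
      filter_upwards [eventually_gt_atTop 0] with N hN
      have hN' : (N : ℂ) ≠ 0 := by exact_mod_cast hN.ne'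
      have h2 : ∀ u, echar (p u) θ = 1 := by
        intro u
        rw [echar_eq_one_iff]
        obtain ⟨k, hk⟩ := hdvd u
        rw [hk, mul_zsmul', natCast_zsmul, show W • θ = 0 from hθK, smul_zero]
      simp [hF, cesaroAvg, h2, hN']
    · rw [Set.indicator_of_notMem hθK]
      have htor : ∀ c : ℤ, c ≠ 0 → echar 1 θ ^ c ≠ 1 := by
        intro c hc h
        rw [← echar_eq_zpow, echar_eq_one_iff] at h
        refine hθ ⟨⟨c.natAbs, by omega, ?_⟩, hθK⟩
        rcases Int.natAbs_eq c with h' | h'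
        · rw [h', natCast_zsmul] at h; exact h
        · rw [h', neg_zsmul, natCast_zsmul, neg_eq_zero] at h; exact h
      refine (tendsto_cesaroAvg_zpow (norm_echar 1 θ) htor hp).congr fun N => ?_
      simp only [hF, ← echar_eq_zpow]
  have hval : ∫ θ in Bdᶜ, K.indicator (fun _ => (1 : ℂ)) θ ∂μ = (μ.real K : ℂ) := by
    rw [setIntegral_indicator hKm]
    have : Bdᶜ ∩ K = K := Set.inter_eq_right.2 fun θ hθ h => h.2 hθ
    rw [this]
    simp
  rw [hval] at hlim
  have h3 : μ.real K ≤ μ.real Bd := by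
    have h4 := le_of_tendsto hlim.norm (Eventually.of_forall hbound)
    simpa [abs_of_nonneg] using h4
  have h5 : μ.real {0} ≤ μ.real K := measureReal_mono (by simp [hK])
  linarith

/-- A sequence of finite sets of integers of uniformly positive density in longer and longer
intervals has, for a suitable modulus `W`, differences along every sequence of polynomial type
with terms divisible by `W`. -/
theorem exists_modulus_difference {A : ℕ → Finset ℤ} {L : ℕ → ℕ} {δ : ℝ} (hδ : 0 < δ)
    (hA : ∀ i, A i ⊆ Finset.Ico 0 (L i : ℤ)) (hd : ∀ i, δ * L i ≤ (A i).card)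
    (hne : ∀ i, (A i).Nonempty) (hL : Tendsto L atTop atTop) :
    ∃ W : ℕ, 1 ≤ W ∧ ∀ (n : ℕ) (p : ℕ → ℤ), PolyLike (n + 1) p → (∀ u, (W : ℤ) ∣ p u) →
      ∃ u i, ∃ x ∈ A i, ∃ y ∈ A i, y - x = p u := by
  let ν : ℕ → ProbabilityMeasure (AddCircle (1 : ℝ)) := fun i =>
    ⟨spectralMeasure (A i), isProbabilityMeasure_spectralMeasure (hne i)⟩
  set F : Ultrafilter ℕ := Ultrafilter.of atTop
  have hFle : (F : Filter ℕ) ≤ atTop := Ultrafilter.of_le _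
  obtain ⟨σ, -, hσ⟩ := isCompact_univ.ultrafilter_le_nhds (F.map ν) (by simp)
  have hσ' : Tendsto ν F (𝓝 σ) := hσ
  have hδ0 : δ ≤ (σ : Measure (AddCircle (1 : ℝ))).real {0} := by
    refine ge_of_tendsto (tendsto_integral_cesaroAvg_echar _) ?_
    filter_upwards [eventually_ge_atTop 1] with N hN
    have h1 := ProbabilityMeasure.tendsto_iff_forall_integral_tendsto.1 hσ'
      (BoundedContinuousFunction.mkOfCompact
        ⟨fun θ => ‖cesaroAvg (fun u => echar u θ) N‖ ^ 2,
          (continuous_cesaroAvg (fun u => continuous_echar u) N).norm.pow 2⟩)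
    have h2 : Tendsto (fun i => δ * (L i : ℝ) / (L i + N)) F (𝓝 δ) := by
      have h3 : Tendsto (fun i => (L i : ℝ)) atTop atTop :=
        tendsto_natCast_atTop_atTop.comp hL
      have h4 : Tendsto (fun i => δ - δ * N / (L i + N)) atTop (𝓝 (δ - 0)) :=
        tendsto_const_nhds.sub
          (tendsto_const_nhds.div_atTop (tendsto_atTop_add_const_right _ _ h3))
      rw [sub_zero] at h4
      refine (h4.congr fun i => ?_).mono_left hFle
      have h5 : (0 : ℝ) < L i + N := by
        have : (1 : ℝ) ≤ N := by exact_mod_cast hN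
        positivity
      field_simp
      ring
    refine le_of_tendsto_of_tendsto h2 h1 (Eventually.of_forall fun i => ?_)
    refine le_trans ?_ (le_integral_cesaroAvg_spectralMeasure (hne i) (hA i) hN)
    exact div_le_div_of_nonneg_right (hd i) (by positivity)
  obtain ⟨W, hW, h⟩ := exists_integral_echar_ne_zero (σ : Measure (AddCircle (1 : ℝ)))
    (hδ.trans_le hδ0)
  refine ⟨W, hW, fun n p hp hdvd => ?_⟩
  obtain ⟨u, hu⟩ := h n p hp hdvd
  have h1 := (ProbabilityMeasure.tendsto_iff_forall_integral_rclike_tendsto ℂ).1 hσ'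
    (BoundedContinuousFunction.mkOfCompact ⟨echar (p u), continuous_echar _⟩)
  obtain ⟨i, hi⟩ := (h1.eventually_ne hu).exists
  exact ⟨u, i, integral_echar_spectralMeasure _ _ hi⟩

/-- The word `w` occurs in the word `W` at position `p`. -/
def Occ (w W : List Bool) (p : ℕ) : Prop := ∃ s t, W = s ++ w ++ t ∧ s.length = p

lemma Occ.refl (w : List Bool) : Occ w w 0 := ⟨[], [], by simp, rfl⟩

lemma Occ.trans {u v w : List Bool} {p q : ℕ} (h : Occ u v p) (h' : Occ v w q) :
    Occ u w (q + p) := by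
  obtain ⟨s, t, rfl, rfl⟩ := h
  obtain ⟨s', t', rfl, rfl⟩ := h'
  exact ⟨s' ++ s, t ++ t', by simp, by simp⟩

lemma Occ.append_right {w X : List Bool} {p : ℕ} (h : Occ w X p) (Y : List Bool) :
    Occ w (X ++ Y) p := by
  obtain ⟨s, t, rfl, rfl⟩ := h
  exact ⟨s, t ++ Y, by simp, rfl⟩

lemma Occ.append_left {w Y : List Bool} {p : ℕ} (h : Occ w Y p) (X : List Bool) :
    Occ w (X ++ Y) (X.length + p) := by
  obtain ⟨s, t, rfl, rfl⟩ := h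
  exact ⟨X ++ s, t, by simp, by simp⟩

lemma Occ.add_length_le {w W : List Bool} {p : ℕ} (h : Occ w W p) :
    p + w.length ≤ W.length := by
  obtain ⟨s, t, rfl, rfl⟩ := h
  simp only [List.length_append]
  omega

lemma Bblk_succ_succ {n k : ℕ} (h : k < n) :
    Bblk (n + 1) (k + 1) = Bblk n (k + 1) ++ Bblk n k := by
  rw [Bblk, if_neg (by omega)]

lemma length_Bblk {n k : ℕ} (h : k ≤ n) : (Bblk n k).length = n.choose k := by
  induction n generalizing k with
  | zero =>
    obtain rfl : k = 0 := by omega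
    simp [Bblk]
  | succ n ih =>
    cases k with
    | zero => simp [Bblk]
    | succ k =>
      rcases (show k = n ∨ k < n by omega) with rfl | hlt
      · simp [Bblk]
      · rw [Bblk_succ_succ hlt, List.length_append, ih hlt, ih hlt.le, Nat.choose_succ_succ,
          add_comm]

lemma length_Bblk_pos {n k : ℕ} (h : k ≤ n) : 0 < (Bblk n k).length := by
  rw [length_Bblk h]
  exact Nat.choose_pos h

lemma occ_Bblk_left {n n' k : ℕ} (hk : 1 ≤ k) (hkn : k ≤ n) (hn : n ≤ n') :
    Occ (Bblk n k) (Bblk n' k) 0 := by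
  induction n', hn using Nat.le_induction with
  | base => exact Occ.refl _
  | succ n' hn ih =>
    obtain ⟨k, rfl⟩ : ∃ j, k = j + 1 := ⟨k - 1, by omega⟩
    rw [Bblk_succ_succ (by omega)]
    exact ih.append_right _

lemma occ_Bblk_right {n k : ℕ} (hkn : k < n) :
    Occ (Bblk n k) (Bblk (n + 1) (k + 1)) (n.choose (k + 1)) := by
  rw [Bblk_succ_succ hkn, ← length_Bblk hkn]
  exact (Occ.refl _).append_left _

lemma occ_Bblk_jump {m k r n : ℕ} (hk : 1 ≤ k) (hkm : k < m) (hmr : m ≤ r) (hrn : r < n) :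
    Occ (Bblk m k) (Bblk n (k + 1)) (r.choose (k + 1)) := by
  have h1 := occ_Bblk_left hk hkm.le hmr
  have h2 := occ_Bblk_right (hkm.trans_le hmr)
  have h3 := occ_Bblk_left (n := r + 1) (n' := n) (k := k + 1) (by omega) (by omega) hrn
  simpa using (h1.trans h2).trans h3

open Classical in
/-- The set of positions at which `w` occurs in `W`. -/
noncomputable def occSet (w W : List Bool) : Finset ℕ := {p ∈ range W.length | Occ w W p}

lemma mem_occSet {w W : List Bool} (hw : 0 < w.length) {p : ℕ} : p ∈ occSet w W ↔ Occ w W p := by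
  classical
  rw [occSet, Finset.mem_filter, Finset.mem_range, and_iff_right_iff_imp]
  intro h
  have := h.add_length_le
  omega

lemma card_occSet_append {w : List Bool} (hw : 0 < w.length) (X Y : List Bool) :
    (occSet w X).card + (occSet w Y).card ≤ (occSet w (X ++ Y)).card := by
  have hd : Disjoint (occSet w X) ((occSet w Y).map (addLeftEmbedding X.length)) := by
    rw [Finset.disjoint_left]
    intro p hp hp'
    obtain ⟨q, -, rfl⟩ := Finset.mem_map.1 hp'
    have := ((mem_occSet hw).1 hp).add_length_le
    simp at this
    omega
  rw [← Finset.card_map (addLeftEmbedding X.length) (s := occSet w Y),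
    ← Finset.card_union_of_disjoint hd]
  refine Finset.card_le_card fun p hp => ?_
  rw [mem_occSet hw]
  rcases Finset.mem_union.1 hp with hp | hp
  · exact ((mem_occSet hw).1 hp).append_right _
  · obtain ⟨q, hq, rfl⟩ := Finset.mem_map.1 hp
    exact ((mem_occSet hw).1 hq).append_left _

lemma choose_le_card_occSet {m k : ℕ} (hk : 1 ≤ k) (hkm : k < m) (j i : ℕ) :
    j.choose i ≤ (occSet (Bblk m k) (Bblk (m + j) (k + i))).card := by
  have hw := length_Bblk_pos hkm.le
  induction j generalizing i with
  | zero =>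
    cases i with
    | zero =>
      rw [Nat.choose_self]
      exact Finset.card_pos.2 ⟨0, (mem_occSet hw).2 (Occ.refl _)⟩
    | succ i => simp
  | succ j ih =>
    cases i with
    | zero =>
      rw [Nat.choose_zero_right]
      exact Finset.card_pos.2 ⟨0, (mem_occSet hw).2 (occ_Bblk_left hk hkm.le (by omega))⟩
    | succ i =>
      rcases lt_or_ge j i with hij | hij
      · rw [Nat.choose_eq_zero_of_lt (by omega)]
        exact Nat.zero_le _
      · rw [← add_assoc, ← add_assoc, Bblk_succ_succ (by omega), Nat.choose_succ_succ, add_comm]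
        exact (add_le_add (ih (i + 1)) (ih i)).trans (card_occSet_append hw _ _)

lemma choose_add_le_two_pow_mul_centralBinom (i m c : ℕ) :
    (2 * i + m).choose c ≤ 2 ^ m * i.centralBinom := by
  induction m generalizing c with
  | zero => simpa using Nat.choose_le_centralBinom c i
  | succ m ih =>
    cases c with
    | zero =>
      rw [Nat.choose_zero_right]
      exact Nat.mul_pos (by positivity) (Nat.centralBinom_pos i)
    | succ c =>
      rw [← add_assoc, Nat.choose_succ_succ, pow_succ]
      linarith [ih c, ih (c + 1)]

lemma le_choose_add (x : ℕ) {l : ℕ} (hl : 1 ≤ l) : x ≤ (x + l).choose l := by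
  obtain ⟨l, rfl⟩ : ∃ j, l = j + 1 := ⟨l - 1, by omega⟩
  induction x with
  | zero => exact Nat.zero_le _
  | succ x ih =>
    rw [show x + 1 + (l + 1) = (x + (l + 1)) + 1 by ring, Nat.choose_succ_succ']
    have : 0 < (x + (l + 1)).choose l := Nat.choose_pos (by omega)
    omega

lemma dvd_choose_mul_factorial {W l b : ℕ} (hb : 1 ≤ b) (hbl : b ≤ l) :
    W ∣ (W * l.factorial).choose b := by
  obtain ⟨t, ht⟩ := Nat.dvd_factorial hb hbl
  rcases Nat.eq_zero_or_pos W with rfl | hW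
  · rw [zero_mul, Nat.choose_eq_zero_of_lt (by omega)]
  obtain ⟨M, hM⟩ : ∃ M, W * l.factorial = M + 1 :=
    ⟨W * l.factorial - 1, by have := Nat.mul_pos hW l.factorial_pos; omega⟩
  obtain ⟨b, rfl⟩ : ∃ j, b = j + 1 := ⟨b - 1, by omega⟩
  have h := Nat.add_one_mul_choose_eq M b
  rw [← hM, ht] at h
  refine ⟨t * M.choose b, ?_⟩
  rw [ht]
  refine Nat.eq_of_mul_eq_mul_right (Nat.succ_pos b) ?_
  rw [Nat.succ_eq_add_one, ← h]
  ring

lemma choose_add_mul_modEq (W l x u : ℕ) :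
    (x + W * l.factorial * u).choose l ≡ x.choose l [MOD W] := by
  induction u with
  | zero => rfl
  | succ u ih =>
    refine Nat.ModEq.trans ?_ ih
    rw [mul_add, mul_one, ← add_assoc]
    generalize x + W * l.factorial * u = y
    rw [Nat.add_choose_eq, Finset.Nat.sum_antidiagonal_eq_sum_range_succ_mk,
      Finset.sum_range_succ, Nat.sub_self, Nat.choose_zero_right, mul_one]
    have : W ∣ ∑ a ∈ range l, y.choose a * (W * l.factorial).choose (l - a) :=
      Finset.dvd_sum fun a ha => Dvd.dvd.mul_left (dvd_choose_mul_factorial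
        (by have := Finset.mem_range.1 ha; omega) (Nat.sub_le _ _)) _
    simpa using (Nat.modEq_zero_iff_dvd.2 this).add_right (y.choose l)

lemma exists_occ_sub_modEq {m k : ℕ} (hk : 1 ≤ k) (hkm : k < m) {W : ℕ} (hW : 1 ≤ W) (j : ℕ) :
    ∃ n K p q, 1 ≤ K ∧ K < n ∧ Occ (Bblk m k) (Bblk n K) p ∧ Occ (Bblk m k) (Bblk n K) q ∧
      p ≡ q + j [MOD W] := by
  induction j with
  | zero => exact ⟨m, k, 0, 0, hk, hkm, Occ.refl _, Occ.refl _, rfl⟩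
  | succ j ih =>
    obtain ⟨n, K, p, q, hK, hKn, hp, hq, hpq⟩ := ih
    set c := W * (K + 1).factorial with hc
    have hcpos : 0 < c := Nat.mul_pos hW (Nat.factorial_pos _)
    have hcn : n ≤ c * n := Nat.le_mul_of_pos_left n hcpos
    have h0 := choose_add_mul_modEq W (K + 1) 0 n
    have h1 := choose_add_mul_modEq W (K + 1) (K + 1) n
    rw [← hc] at h0 h1
    rw [Nat.choose_self] at h1
    rw [Nat.choose_eq_zero_of_lt (Nat.succ_pos K)] at h0
    have o1 := occ_Bblk_jump (n := K + 1 + c * n + 1) hK hKn (r := K + 1 + c * n)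
      (by omega) (by omega)
    have o0 := occ_Bblk_jump (n := K + 1 + c * n + 1) hK hKn (r := 0 + c * n)
      (by omega) (by omega)
    refine ⟨K + 1 + c * n + 1, K + 1, _, _, by omega, by omega, hp.trans o1, hq.trans o0, ?_⟩
    have h2 := h1.add hpq
    rw [show 1 + (q + j) = 0 + (q + (j + 1)) by ring] at h2
    simpa [add_assoc] using h2.trans (h0.symm.add_right (q + (j + 1)))

/-- The word `w` occurs twice in some interior block with positions differing by `D`. -/
def Returns (w : List Bool) (D : ℕ) : Prop :=
  ∃ n K p, 1 ≤ K ∧ K < n ∧ Occ w (Bblk n K) p ∧ Occ w (Bblk n K) (p + D)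

lemma tendsto_centralBinom_atTop : Tendsto Nat.centralBinom atTop atTop := by
  refine tendsto_atTop_mono' atTop ?_ tendsto_id
  filter_upwards [eventually_ge_atTop 4] with n hn
  have h1 := Nat.four_pow_lt_mul_centralBinom n hn
  have h2 : n * n ≤ 4 ^ n := by
    have := (Nat.lt_two_pow_self (n := n)).le
    calc n * n ≤ 2 ^ n * 2 ^ n := Nat.mul_le_mul this this
      _ = 4 ^ n := by rw [← mul_pow]; norm_num
  exact (lt_of_mul_lt_mul_left (h2.trans_lt h1) (Nat.zero_le n)).le

lemma exists_modulus_returns {m k : ℕ} (hk : 1 ≤ k) (hkm : k < m) :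
    ∃ W : ℕ, 1 ≤ W ∧ ∀ (n : ℕ) (p : ℕ → ℤ), PolyLike (n + 1) p → (∀ u, (W : ℤ) ∣ p u) →
      (∀ u, 0 ≤ p u) → ∃ u, Returns (Bblk m k) (p u).toNat := by
  have hw := length_Bblk_pos hkm.le
  have hcard : ∀ i, i.centralBinom ≤ (occSet (Bblk m k) (Bblk (m + 2 * i) (k + i))).card :=
    fun i => choose_le_card_occSet hk hkm (2 * i) i
  have hlen : ∀ i, (Bblk (m + 2 * i) (k + i)).length = (m + 2 * i).choose (k + i) :=
    fun i => length_Bblk (by omega)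
  obtain ⟨W, hW, h⟩ := exists_modulus_difference
    (A := fun i => (occSet (Bblk m k) (Bblk (m + 2 * i) (k + i))).map Nat.castEmbedding)
    (L := fun i => (m + 2 * i).choose (k + i)) (δ := ((2 : ℝ) ^ m)⁻¹) (by positivity)
    (by
      intro i x hx
      obtain ⟨p, hp, rfl⟩ := Finset.mem_map.1 hx
      have := ((mem_occSet hw).1 hp).add_length_le
      rw [hlen] at this
      simp
      omega)
    (by
      intro i
      rw [Finset.card_map, inv_mul_le_iff₀ (by positivity)]
      have h1 := choose_add_le_two_pow_mul_centralBinom i m (k + i)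
      rw [add_comm] at h1
      exact_mod_cast h1.trans (Nat.mul_le_mul_left _ (hcard i)))
    (by
      intro i
      rw [Finset.map_nonempty, ← Finset.card_pos]
      exact (Nat.centralBinom_pos i).trans_le (hcard i))
    (by
      refine tendsto_atTop_mono (fun i => (hcard i).trans ?_) tendsto_centralBinom_atTop
      rw [← hlen, ← Finset.card_range (Bblk (m + 2 * i) (k + i)).length]
      refine Finset.card_le_card fun p hp => Finset.mem_range.2 ?_
      have := ((mem_occSet hw).1 hp).add_length_le
      omega)
  refine ⟨W, hW, fun n p hp hdvd hnn => ?_⟩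
  obtain ⟨u, i, x, hx, y, hy, hxy⟩ := h n p hp hdvd
  obtain ⟨x, hx', rfl⟩ := Finset.mem_map.1 hx
  obtain ⟨y, hy', rfl⟩ := Finset.mem_map.1 hy
  refine ⟨u, m + 2 * i, k + i, x, by omega, by omega, (mem_occSet hw).1 hx', ?_⟩
  have e : x + (p u).toNat = y := by
    have := hnn u
    simp only [Nat.castEmbedding_apply] at hxy
    omega
  rw [e]
  exact (mem_occSet hw).1 hy'

/-- The return times of an interior block contain pairs of arbitrarily large elements with any
prescribed difference. -/
theorem exists_returns_pair {m k : ℕ} (hk : 1 ≤ k) (hkm : k < m) (d : ℤ) (B : ℕ) :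
    ∃ D₁ D₂ : ℕ, B ≤ D₁ ∧ B ≤ D₂ ∧ (D₁ : ℤ) = D₂ + d ∧
      Returns (Bblk m k) D₁ ∧ Returns (Bblk m k) D₂ := by
  obtain ⟨W, hW, h⟩ := exists_modulus_returns hk hkm
  obtain ⟨n, K, p, q, hK, hKn, hp, hq, hpq⟩ := exists_occ_sub_modEq hk hkm hW (d % W).toNat
  set c := W * (K + 1).factorial with hc
  have hcpos : 0 < c := Nat.mul_pos hW (Nat.factorial_pos _)
  set t := q + n.choose (K + 1) + B + d.natAbs + (K + 1) with ht
  have hct : t ≤ c * t := Nat.le_mul_of_pos_left t hcpos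
  have hlarge : ∀ u, q + n.choose (K + 1) + B + d.natAbs
      ≤ (n + c * t + c * u).choose (K + 1) := fun u =>
    (le_choose_add _ (Nat.succ_pos K)).trans (Nat.choose_le_choose _ (by omega))
  have hmod : ∀ u, (n + c * t + c * u).choose (K + 1) ≡ n.choose (K + 1) [MOD W] := fun u => by
    rw [add_assoc, ← mul_add]
    exact choose_add_mul_modEq W (K + 1) n (t + u)
  have hpoly := ((polyLike_choose (K + 1)).comp_affine (n + c * t) hcpos).add_const
    ((p : ℤ) - q - n.choose (K + 1) - d)
  obtain ⟨u, hu⟩ := h K _ hpoly (fun u => by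
      have h1 := (Nat.modEq_iff_dvd.1 (hmod u))
      have h2 := (Nat.modEq_iff_dvd.1 hpq)
      have h3 : (W : ℤ) ∣ d % W - d := ⟨-(d / W), by have := Int.emod_add_mul_ediv d W; linarith⟩
      have h4 : 0 ≤ d % W := Int.emod_nonneg _ (by omega)
      push_cast [Int.toNat_of_nonneg h4] at h2
      obtain ⟨x, hx⟩ := h1
      obtain ⟨y, hy⟩ := h2
      obtain ⟨z, hz⟩ := h3
      exact ⟨z - y - x, by linear_combination hz - hy - hx⟩) (fun u => by
      have := hlarge u
      omega)
  have hl := hlarge u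
  refine ⟨((n + c * t + c * u).choose (K + 1) + p - (q + n.choose (K + 1))), _, ?_, ?_, ?_,
    ⟨n + c * t + c * u + 1, K + 1, n.choose (K + 1) + q, by omega, by omega,
      hq.trans (occ_Bblk_jump hK hKn le_rfl (by omega)), ?_⟩, hu⟩
  · omega
  · omega
  · omega
  · have o := hp.trans (occ_Bblk_jump (n := n + c * t + c * u + 1) hK hKn
      (r := n + c * t + c * u) (by omega) (by omega))
    convert o using 1
    omega

lemma Occ.getElem? {w W : List Bool} {p x : ℕ} (h : Occ w W p) (hx : x < w.length) :
    W[p + x]? = w[x]? := by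
  obtain ⟨s, t, rfl, rfl⟩ := h
  rw [List.append_assoc, List.getElem?_append_right (by omega), Nat.add_sub_cancel_left,
    List.getElem?_append_left hx]

lemma exists_occ_of_infix {w W : List Bool} (h : w <:+: W) : ∃ p, Occ w W p := by
  obtain ⟨s, t, h⟩ := h
  exact ⟨s.length, s, t, h.symm, rfl⟩

lemma comp_add_mem_Sig {ω : ℤ → Bool} (h : ω ∈ Sig) (c : ℤ) : (fun i => ω (i + c)) ∈ Sig := by
  intro i m hm
  obtain ⟨n, k, h1, h2, h3⟩ := h (i + c) m hm
  refine ⟨n, k, h1, h2, ?_⟩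
  have e : (fun t : Fin m => ω (i + (t : ℕ) + c)) = fun t : Fin m => ω (i + c + (t : ℕ)) := by
    funext t
    congr 1
    ring
  rw [e]
  exact h3

/-- An increasing sequence of blocks, each occurring strictly inside the next one, has a
bi-infinite limit in the Pascal subshift. -/
lemma exists_mem_Sig_of_chain {w : ℕ → List Bool} {c : ℕ → ℕ}
    (hw : ∀ j, ∃ n k, 1 ≤ n ∧ k ≤ n ∧ w j = Bblk n k) (h0 : 0 < (w 0).length)
    (hocc : ∀ j, Occ (w j) (w (j + 1)) (c j)) (hc : ∀ j, 1 ≤ c j)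
    (hlen : ∀ j, c j + (w j).length + 1 ≤ (w (j + 1)).length) :
    ∃ ω ∈ Sig, ∀ x : ℕ, x < (w 0).length → (w 0)[x]? = some (ω x) := by
  set off : ℕ → ℕ := fun j => ∑ t ∈ range j, c t with hoff
  have off_succ : ∀ j, off (j + 1) = off j + c j := fun j => Finset.sum_range_succ _ _
  have off_ge : ∀ j, j ≤ off j := by
    intro j
    induction j with
    | zero => exact Nat.zero_le _
    | succ j ih => rw [off_succ]; have := hc j; omega
  have len_ge : ∀ j, j + 1 + off j ≤ (w j).length := by
    intro j
    induction j with
    | zero => simpa [hoff] using Nat.succ_le_of_lt h0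
    | succ j ih => rw [off_succ]; have := hlen j; omega
  have mono : ∀ j j', j ≤ j' → ∃ d, off j' = off j + d ∧ Occ (w j) (w j') d := by
    intro j j' hj
    induction j', hj using Nat.le_induction with
    | base => exact ⟨0, rfl, Occ.refl _⟩
    | succ j' _ ih =>
      obtain ⟨d, hd, ho⟩ := ih
      exact ⟨c j' + d, by rw [off_succ]; omega, ho.trans (hocc j')⟩
  have consistent : ∀ (j j' : ℕ) (i : ℤ), j ≤ j' → 0 ≤ i + off j → i + off j < (w j).length →
      (w j')[(i + off j').toNat]? = (w j)[(i + off j).toNat]? := by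
    intro j j' i hj h1 h2
    obtain ⟨d, hd, ho⟩ := mono j j' hj
    rw [← ho.getElem? (x := (i + off j).toNat) (by omega)]
    congr 1
    omega
  set ω : ℤ → Bool := fun i => ((w i.natAbs)[(i + off i.natAbs).toNat]?).getD false with hω
  have key : ∀ (j : ℕ) (i : ℤ), 0 ≤ i + off j → i + off j < (w j).length →
      (w j)[(i + off j).toNat]? = some (ω i) := by
    intro j i h1 h2
    have a1 := off_ge i.natAbs
    have a2 := len_ge i.natAbs
    have h3 : (w i.natAbs)[(i + off i.natAbs).toNat]? = (w j)[(i + off j).toNat]? := by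
      rcases le_total j i.natAbs with hj | hj
      · exact consistent _ _ i hj h1 h2
      · exact (consistent _ _ i hj (by omega) (by omega)).symm
    simp only [hω]
    rw [h3, List.getElem?_eq_getElem (by omega)]
    rfl
  refine ⟨ω, ?_, ?_⟩
  · intro i m hm
    set j := i.natAbs + m with hj
    have a1 := off_ge j
    have a2 := len_ge j
    obtain ⟨n, k, hn, hk, hnk⟩ := hw j
    refine ⟨n, k, hn, hk, ?_⟩
    rw [← hnk]
    have e : (List.ofFn fun t : Fin m => ω (i + (t : ℕ)))
        = ((w j).drop (i + off j).toNat).take m := by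
      refine List.ext_getElem? fun t => ?_
      by_cases ht : t < m
      · rw [List.getElem?_take_of_lt ht, List.getElem?_drop, List.getElem?_ofFn, dif_pos ht]
        have := key j (i + t) (by omega) (by omega)
        rw [← this]
        congr 1
        omega
      · rw [List.getElem?_eq_none (by simpa using ht), List.getElem?_eq_none (by simp; omega)]
    rw [e]
    exact (List.take_prefix _ _).isInfix.trans (List.drop_suffix _ _).isInfix
  · intro x hx
    have := key 0 x (by simp [hoff]) (by simpa [hoff] using hx)
    simpa [hoff] using this

lemma exists_mem_Sig_of_Bblk {n k : ℕ} (hk : 1 ≤ k) (hkn : k < n) :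
    ∃ ω ∈ Sig, ∀ x : ℕ, x < (Bblk n k).length → (Bblk n k)[x]? = some (ω x) := by
  refine exists_mem_Sig_of_chain (w := fun j => Bblk (n + 2 * j) (k + j))
    (c := fun j => (n + 2 * j).choose (k + j + 1)) (fun j => ⟨_, _, by omega, by omega, rfl⟩)
    (length_Bblk_pos hkn.le) (fun j => ?_) (fun j => Nat.choose_pos (by omega)) (fun j => ?_)
  · exact occ_Bblk_jump (by omega) (by omega) le_rfl (by omega)
  · rw [length_Bblk (by omega), length_Bblk (by omega),
      show n + 2 * (j + 1) = n + 2 * j + 1 + 1 by ring, ← add_assoc, Nat.choose_succ_succ',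
      Nat.choose_succ_succ' (n + 2 * j) (k + j)]
    have : 0 < (n + 2 * j + 1).choose (k + j) := Nat.choose_pos (by omega)
    omega

/-- The central window of radius `L` of a bi-infinite sequence. -/
def window (x : ℤ → Bool) (L : ℕ) : List Bool :=
  List.ofFn fun t : Fin (2 * L + 1) => x (-L + (t : ℕ))

lemma getElem?_window (x : ℤ → Bool) {L : ℕ} {i : ℤ} (hi : i.natAbs ≤ L) :
    (window x L)[(i + L).toNat]? = some (x i) := by
  rw [window, List.getElem?_ofFn, dif_pos (by omega)]
  congr 2
  simp only
  omega

lemma exists_mem_Sig_of_occ_window {n K : ℕ} (hK : 1 ≤ K) (hKn : K < n) {x y : ℤ → Bool}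
    {L p q : ℕ} (hx : Occ (window x L) (Bblk n K) p) (hy : Occ (window y L) (Bblk n K) q) :
    ∃ z ∈ Sig, (∀ i : ℤ, i.natAbs ≤ L → z i = x i) ∧
      ∀ i : ℤ, i.natAbs ≤ L → z (i + (q - p)) = y i := by
  obtain ⟨ω, hω, h⟩ := exists_mem_Sig_of_Bblk hK hKn
  have aux : ∀ (x : ℤ → Bool) (p : ℕ), Occ (window x L) (Bblk n K) p →
      ∀ i : ℤ, i.natAbs ≤ L → ω (i + (L + p)) = x i := by
    intro x p hx i hi
    have hl : (window x L).length = 2 * L + 1 := by simp [window]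
    have h1 := hx.getElem? (x := (i + L).toNat) (by omega)
    have h2 := hx.add_length_le
    rw [getElem?_window x hi, h _ (by omega), Option.some_inj] at h1
    rw [← h1]
    congr 1
    omega
  refine ⟨_, comp_add_mem_Sig hω (L + p), aux x p hx, fun i hi => ?_⟩
  rw [← aux y q hy i hi]
  congr 1
  ring

lemma exists_interior_occ {w : List Bool} {n k : ℕ} (hn : 1 ≤ n) (hk : k ≤ n)
    (h : w <:+: Bblk n k) : ∃ n' k' p, 1 ≤ k' ∧ k' < n' ∧ Occ w (Bblk n' k') p := by
  obtain ⟨p, hp⟩ := exists_occ_of_infix h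
  obtain ⟨n, rfl⟩ : ∃ j, n = j + 1 := ⟨n - 1, by omega⟩
  have e : Bblk 2 1 = [true, false] := by decide
  rcases Nat.eq_zero_or_pos k with rfl | hk0
  · refine ⟨2, 1, _, le_rfl, by norm_num, hp.trans (q := 1) ?_⟩
    exact ⟨[true], [], by rw [e]; simp [Bblk], rfl⟩
  · rcases hk.lt_or_eq with hlt | rfl
    · exact ⟨n + 1, k, p, hk0, hlt, hp⟩
    · refine ⟨2, 1, _, le_rfl, by norm_num, hp.trans (q := 0) ?_⟩
      exact ⟨[], [false], by rw [e]; simp [Bblk], rfl⟩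

lemma exists_occ_Bblk_Bblk {n k : ℕ} (hk : 1 ≤ k) (hkn : k < n) (a b : ℕ) :
    ∃ p, Occ (Bblk n k) (Bblk (n + a + b) (k + a)) p := by
  induction a with
  | zero => exact ⟨0, occ_Bblk_left hk hkn.le (by omega)⟩
  | succ a ih =>
    obtain ⟨p, hp⟩ := ih
    refine ⟨_, hp.trans (occ_Bblk_jump (r := n + a + b) (n := n + (a + 1) + b) ?_ ?_ le_rfl ?_)⟩ <;>
      omega

/-- Finitely many words of the language occur in a common interior block. -/
lemma exists_common_block (w : Fin 4 → List Bool)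
    (h : ∀ i, ∃ n k, 1 ≤ n ∧ k ≤ n ∧ w i <:+: Bblk n k) :
    ∃ m k, 1 ≤ k ∧ k < m ∧ ∀ i, ∃ p, Occ (w i) (Bblk m k) p := by
  have h' : ∀ i, ∃ n' k' p, 1 ≤ k' ∧ k' < n' ∧ Occ (w i) (Bblk n' k') p := fun i => by
    obtain ⟨n, k, hn, hk, hi⟩ := h i
    exact exists_interior_occ hn hk hi
  choose n k p hk hkn hp using h'
  have hs : ∀ (f : Fin 4 → ℕ) (i : Fin 4), f i ≤ ∑ j, f j := fun f i =>
    Finset.single_le_sum (fun _ _ => Nat.zero_le _) (Finset.mem_univ i)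
  refine ⟨∑ j, k j + ∑ j, (n j - k j), ∑ j, k j, (hk 0).trans (hs k 0), ?_, fun i => ?_⟩
  · have := hs (fun j => n j - k j) 0
    have := hkn 0
    omega
  · have h1 := hs k i
    have h2 := hs (fun j => n j - k j) i
    have h3 := hkn i
    obtain ⟨q, hq⟩ := exists_occ_Bblk_Bblk (hk i) h3 (∑ j, k j - k i)
      (∑ j, (n j - k j) - (n i - k i))
    rw [show n i + (∑ j, k j - k i) + (∑ j, (n j - k j) - (n i - k i))
      = ∑ j, k j + ∑ j, (n j - k j) by omega, show k i + (∑ j, k j - k i) = ∑ j, k j by omega] at hq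
    exact ⟨_, (hp i).trans hq⟩

lemma exists_cylinder_subset {U : Set ↥Sig} (hU : IsOpen U) {x : ↥Sig} (hx : x ∈ U) :
    ∃ L : ℕ, ∀ z : ↥Sig, (∀ i : ℤ, i.natAbs ≤ L → z.1 i = x.1 i) → z ∈ U := by
  obtain ⟨O, hO, rfl⟩ := isOpen_induced_iff.1 hU
  obtain ⟨I, u, hu, hI⟩ := isOpen_pi_iff.1 hO x.1 hx
  refine ⟨I.sup Int.natAbs, fun z hz => hI fun i hi => ?_⟩
  rw [hz i (Finset.le_sup (f := Int.natAbs) hi)]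
  exact (hu i hi).2

lemma exists_cylinder_prod_subset {U : Set (↥Sig × ↥Sig)} (hU : IsOpen U) {x : ↥Sig × ↥Sig}
    (hx : x ∈ U) : ∃ L₀ : ℕ, ∀ L, L₀ ≤ L → ∀ z₁ z₂ : ↥Sig,
      (∀ i : ℤ, i.natAbs ≤ L → z₁.1 i = x.1.1 i) →
      (∀ i : ℤ, i.natAbs ≤ L → z₂.1 i = x.2.1 i) → (z₁, z₂) ∈ U := by
  obtain ⟨U₁, U₂, h1, h2, hx1, hx2, hsub⟩ := isOpen_prod_iff.1 hU x.1 x.2 hx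
  obtain ⟨L₁, hL₁⟩ := exists_cylinder_subset h1 hx1
  obtain ⟨L₂, hL₂⟩ := exists_cylinder_subset h2 hx2
  exact ⟨max L₁ L₂, fun L hL z₁ z₂ hz₁ hz₂ => hsub
    ⟨hL₁ z₁ fun i hi => hz₁ i (by omega), hL₂ z₂ fun i hi => hz₂ i (by omega)⟩⟩

lemma iterate_sigmaS_apply (N : ℕ) (ω : ↥Sig) (i : ℤ) : (sigmaS^[N] ω).1 i = ω.1 (i + N) := by
  induction N generalizing i with
  | zero => simp
  | succ N ih =>
    rw [Function.iterate_succ_apply']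
    change (sigmaS^[N] ω).1 (i + 1) = _
    rw [ih]
    exact congrArg ω.1 (by push_cast; ring)

/-- Topological weak mixing of the Pascal subshift: the product system
`(Σ × Σ, σ × σ)` is topologically transitive. -/
theorem pascal_subshift_topologically_weak_mixing :
    ∀ U V : Set (↥Sig × ↥Sig), IsOpen U → IsOpen V →
      U.Nonempty → V.Nonempty →
      ∃ N : ℕ, 1 ≤ N ∧ ((Prod.map sigmaS sigmaS)^[N] '' U ∩ V).Nonempty := by
  rintro U V hU hV ⟨⟨x₁, x₂⟩, hx⟩ ⟨⟨y₁, y₂⟩, hy⟩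
  obtain ⟨L₁, hL₁⟩ := exists_cylinder_prod_subset hU hx
  obtain ⟨L₂, hL₂⟩ := exists_cylinder_prod_subset hV hy
  set L := max L₁ L₂
  have hUL := hL₁ L (le_max_left _ _)
  have hVL := hL₂ L (le_max_right _ _)
  have hlang : ∀ z : ↥Sig, ∃ n k, 1 ≤ n ∧ k ≤ n ∧ window z.1 L <:+: Bblk n k :=
    fun z => z.2 (-L) (2 * L + 1) (by omega)
  obtain ⟨m, k, hk, hkm, hocc⟩ := exists_common_block
    ![window x₁.1 L, window x₂.1 L, window y₁.1 L, window y₂.1 L]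
    (fun i => by fin_cases i <;> exact hlang _)
  obtain ⟨p₁, hp₁⟩ := hocc 0
  obtain ⟨p₂, hp₂⟩ := hocc 1
  obtain ⟨q₁, hq₁⟩ := hocc 2
  obtain ⟨q₂, hq₂⟩ := hocc 3
  obtain ⟨D₁, D₂, hD₁, -, hD, ⟨n₁, K₁, s₁, hK₁, hn₁, ho₁, ho₁'⟩,
    ⟨n₂, K₂, s₂, hK₂, hn₂, ho₂, ho₂'⟩⟩ :=
    exists_returns_pair hk hkm (((q₂ : ℤ) - p₂) - (q₁ - p₁)) (p₁ + 1)
  obtain ⟨z₁, hz₁, hz₁x, hz₁y⟩ :=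
    exists_mem_Sig_of_occ_window hK₁ hn₁ (hp₁.trans ho₁) (hq₁.trans ho₁')
  obtain ⟨z₂, hz₂, hz₂x, hz₂y⟩ :=
    exists_mem_Sig_of_occ_window hK₂ hn₂ (hp₂.trans ho₂) (hq₂.trans ho₂')
  refine ⟨D₁ + q₁ - p₁, by omega, _, ⟨(⟨z₁, hz₁⟩, ⟨z₂, hz₂⟩), hUL _ _ hz₁x hz₂x, rfl⟩, ?_⟩
  rw [Prod.map_iterate]
  refine hVL _ _ (fun i hi => ?_) (fun i hi => ?_)
  · rw [iterate_sigmaS_apply, ← hz₁y i hi]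
    exact congrArg z₁ (by omega)
  · rw [iterate_sigmaS_apply, ← hz₂y i hi]
    exact congrArg z₂ (by omega)
end
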